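/- Let μ, ν ∈ P_1(ℝ) and let ψ be the convex hull (the largest convex function bounded above by) of the function [0,1] ∋ q ↦ ∫_0^q (F_μ^{-1}(p) − F_ν^{-1}(p)) dp. Then there exists a probability measure μ_{P̲(ν)} on ℝ such that for all q ∈ [0,1], ∫_0^q F_{μ_{P̲(ν)}}^{-1}(p) dp = ∫_0^q F_μ^{-1}(p) dp − ψ(q). Moreover μ_{P̲(ν)} ≤cx ν, and for each ρ > 1 such that μ, ν ∈ P_ρ(ℝ), μ_{P̲(ν)} is the unique probability measure η with η ≤cx ν minimizing W_ρ(μ,η). -/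

import Mathlib

open MeasureTheory ProbabilityTheory Set
open scoped ENNReal

noncomputable section

/-- `μ ≤cx ν`: convex order between measures on a normed space. -/
def ConvexOrder {E : Type*} [NormedAddCommGroup E] [NormedSpace ℝ E] [MeasurableSpace E]
    (μ ν : Measure E) : Prop :=
  (∀ φ : E → ℝ, ConvexOn ℝ univ φ → (∀ x, 0 ≤ φ x) →
      ∫⁻ x, ENNReal.ofReal (φ x) ∂μ ≤ ∫⁻ x, ENNReal.ofReal (φ x) ∂ν) ∧
  (∀ φ : E → ℝ, ConvexOn ℝ univ φ → Integrable φ (μ + ν) →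
      ∫ x, φ x ∂μ ≤ ∫ x, φ x ∂ν)

/-- `Wp ρ μ ν` is the ρ-th power `W_ρ(μ,ν)^ρ` of the ρ-Wasserstein distance. -/
def Wp {E : Type*} [NormedAddCommGroup E] [MeasurableSpace E]
    (ρ : ℝ) (μ ν : Measure E) : ℝ≥0∞ :=
  ⨅ (π : Measure (E × E)) (_ : π.map Prod.fst = μ) (_ : π.map Prod.snd = ν),
    ∫⁻ p, ENNReal.ofReal (‖p.1 - p.2‖ ^ ρ) ∂π

/-- The quantile function `F_η^{-1}(p) = inf {x : F_η(x) ≥ p}` of a measure on `ℝ`. -/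
def quantileFn (η : Measure ℝ) (p : ℝ) : ℝ :=
  sInf {x : ℝ | p ≤ (η (Iic x)).toReal}

lemma quantile_le_iff (η : Measure ℝ) [IsProbabilityMeasure η] {p : ℝ} (hp : p ∈ Ioo (0:ℝ) 1)
    (x : ℝ) : quantileFn η p ≤ x ↔ p ≤ (η (Iic x)).toReal := by
  have hF : ∀ x, (η (Iic x)).toReal = cdf η x := fun x => by
    rw [cdf_eq_real]; rfl
  have hmono : Monotone fun x => (η (Iic x)).toReal := by
    intro a b hab; simp only [hF]; exact monotone_cdf η hab
  set s := {x : ℝ | p ≤ (η (Iic x)).toReal} with hs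
  have hbdd : BddBelow s := by
    have h := (tendsto_cdf_atBot η).eventually (gt_mem_nhds hp.1)
    obtain ⟨a, ha⟩ := h.exists
    refine ⟨a, fun y hy => ?_⟩
    by_contra hlt
    push Not at hlt
    have h1 : p ≤ cdf η y := by rw [← hF]; exact hy
    have := monotone_cdf η hlt.le
    linarith
  have hne : s.Nonempty := by
    have h := (tendsto_cdf_atTop η).eventually (lt_mem_nhds hp.2)
    obtain ⟨a, ha⟩ := h.exists
    exact ⟨a, by simp only [hs, mem_ofPred_eq, hF]; exact ha.le⟩
  constructor
  · intro h
    have h2 : ∀ y, x < y → p ≤ cdf η y := by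
      intro y hy
      have : sInf s < y := lt_of_le_of_lt h hy
      obtain ⟨z, hz, hzy⟩ := exists_lt_of_csInf_lt hne this
      have h1 : p ≤ cdf η z := by rw [← hF]; exact hz
      exact h1.trans (monotone_cdf η hzy.le)
    rw [hF]
    have hc : Filter.Tendsto (cdf η) (nhdsWithin x (Ioi x)) (nhds (cdf η x)) :=
      ((cdf η).right_continuous x).mono_left (nhdsWithin_mono _ Ioi_subset_Ici_self)
    exact ge_of_tendsto hc (by filter_upwards [self_mem_nhdsWithin] with y hy using h2 y hy)
  · intro h
    exact csInf_le hbdd h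

lemma quantile_mono (η : Measure ℝ) [IsProbabilityMeasure η] :
    MonotoneOn (quantileFn η) (Ioo 0 1) := by
  intro a ha b hb hab
  rw [quantile_le_iff η ha]
  exact hab.trans ((quantile_le_iff η hb _).1 le_rfl)

/-- Lebesgue measure on the unit interval -/
abbrev lam : Measure ℝ := volume.restrict (Ioo (0:ℝ) 1)

instance : IsProbabilityMeasure lam := ⟨by simp [lam]⟩

lemma aemeas_mono {f : ℝ → ℝ} (hf : MonotoneOn f (Ioo 0 1)) : AEMeasurable f lam :=
  aemeasurable_restrict_of_monotoneOn measurableSet_Ioo hf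

lemma quantile_map (η : Measure ℝ) [IsProbabilityMeasure η] :
    lam.map (quantileFn η) = η := by
  have hm := aemeas_mono (quantile_mono η)
  have : IsProbabilityMeasure (lam.map (quantileFn η)) := Measure.isProbabilityMeasure_map hm
  refine Measure.ext_of_Iic _ _ fun x => ?_
  rw [Measure.map_apply_of_aemeasurable hm measurableSet_Iic]
  rw [Measure.restrict_apply' measurableSet_Ioo]
  have h1 : (η (Iic x)).toReal ≤ 1 := by
    have := prob_le_one (μ := η) (s := Iic x)
    exact ENNReal.toReal_le_of_le_ofReal zero_le_one (by simpa using this)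
  have h0 : 0 ≤ (η (Iic x)).toReal := ENNReal.toReal_nonneg
  have e : (quantileFn η ⁻¹' Iic x ∩ Ioo 0 1) = Iic (η (Iic x)).toReal ∩ Ioo 0 1 := by
    ext p
    constructor
    · rintro ⟨h, hp⟩; exact ⟨(quantile_le_iff η hp x).1 h, hp⟩
    · rintro ⟨h, hp⟩; exact ⟨(quantile_le_iff η hp x).2 h, hp⟩
  rw [e]
  have h3 : volume (Iic (η (Iic x)).toReal ∩ Ioo 0 1) = ENNReal.ofReal (η (Iic x)).toReal := by
    apply le_antisymm
    · calc _ ≤ volume (Ioc 0 (η (Iic x)).toReal) := measure_mono fun p hp => ⟨hp.2.1, hp.1⟩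
        _ = _ := by simp
    · calc _ = volume (Ioo 0 (η (Iic x)).toReal) := by simp
        _ ≤ volume (Iic (η (Iic x)).toReal ∩ Ioo 0 1) :=
          measure_mono fun p hp => ⟨hp.2.le, hp.1, hp.2.trans_le h1⟩
  rw [h3, ENNReal.ofReal_toReal (measure_ne_top _ _)]

lemma quantile_integrable (η : Measure ℝ) [IsProbabilityMeasure η]
    (h : Integrable (fun x => x) η) : Integrable (quantileFn η) lam := by
  have hm := aemeas_mono (quantile_mono η)
  rw [← quantile_map η] at h
  exact (integrable_map_measure (by fun_prop) hm).1 h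

lemma lam_ivl {f : ℝ → ℝ} (hf : Integrable f lam) : IntervalIntegrable f volume 0 1 := by
  rw [intervalIntegrable_iff_integrableOn_Ioo_of_le zero_le_one]
  exact hf

lemma lam_ivl' {f : ℝ → ℝ} (hf : Integrable f lam) {a b : ℝ} (ha : a ∈ Icc (0:ℝ) 1)
    (hb : b ∈ Icc (0:ℝ) 1) : IntervalIntegrable f volume a b :=
  (lam_ivl hf).mono_set (by
    rw [uIcc_of_le (zero_le_one' ℝ)]; exact uIcc_subset_Icc ha hb)

lemma lam_int {f : ℝ → ℝ} : ∫ p, f p ∂lam = ∫ p in (0:ℝ)..1, f p := by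
  rw [intervalIntegral.integral_of_le zero_le_one, integral_Ioc_eq_integral_Ioo]

lemma ae_lam_eq_ivl {f g : ℝ → ℝ} (h : f =ᵐ[lam] g) {a b : ℝ} (ha : a ∈ Icc (0:ℝ) 1)
    (hb : b ∈ Icc (0:ℝ) 1) : ∫ p in a..b, f p = ∫ p in a..b, g p := by
  wlog hab : a ≤ b generalizing a b
  · rw [intervalIntegral.integral_symm, this hb ha (not_le.1 hab).le,
      ← intervalIntegral.integral_symm]
  rw [intervalIntegral.integral_of_le hab, intervalIntegral.integral_of_le hab,
    integral_Ioc_eq_integral_Ioo, integral_Ioc_eq_integral_Ioo]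
  apply integral_congr_ae
  exact ae_restrict_of_ae_restrict_of_subset (Ioo_subset_Ioo ha.1 hb.2) h

/-- the quantile function of the law of a monotone function is that function -/
lemma quantile_of_map {w : ℝ → ℝ} (hw : MonotoneOn w (Ioo 0 1)) :
    quantileFn (lam.map w) =ᵐ[lam] w := by
  have hm := aemeas_mono hw
  have : IsProbabilityMeasure (lam.map w) := Measure.isProbabilityMeasure_map hm
  have hF : ∀ x, (lam.map w) (Iic x) = volume (w ⁻¹' Iic x ∩ Ioo 0 1) := fun x => by
    rw [Measure.map_apply_of_aemeasurable hm measurableSet_Iic,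
      Measure.restrict_apply' measurableSet_Ioo]
  have hle : ∀ p ∈ Ioo (0:ℝ) 1, quantileFn (lam.map w) p ≤ w p := by
    intro p hp
    rw [quantile_le_iff _ hp]
    have : ENNReal.ofReal p ≤ (lam.map w) (Iic (w p)) := by
      rw [hF]
      calc _ = volume (Ioc 0 p) := by simp
        _ ≤ volume (w ⁻¹' Iic (w p) ∩ Ioo 0 1) := measure_mono fun r hr =>
          ⟨hw ⟨hr.1, hr.2.trans_lt hp.2⟩ hp hr.2, hr.1, hr.2.trans_lt hp.2⟩
    exact (ENNReal.ofReal_le_iff_le_toReal (measure_ne_top _ _)).1 this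
  have hge : ∀ p ∈ Ioo (0:ℝ) 1, ∀ r ∈ Ioo (0:ℝ) 1, r < p → w r ≤ quantileFn (lam.map w) p := by
    intro p hp r hr hrp
    by_contra hlt
    push Not at hlt
    have h1 := (quantile_le_iff (lam.map w) hp _).1 le_rfl
    have h2 : (lam.map w) (Iic (quantileFn (lam.map w) p)) ≤ ENNReal.ofReal r := by
      rw [hF]
      calc _ ≤ volume (Ioc 0 r) := measure_mono fun t ht => ⟨ht.2.1, by
              by_contra htr
              push Not at htr
              have := hw hr ht.2 htr.le
              have h3 : w t ≤ _ := ht.1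
              linarith⟩
        _ = _ := by simp
    have h3 := ENNReal.toReal_le_of_le_ofReal hr.1.le h2
    linarith
  have hcount := hw.countable_not_continuousWithinAt
  have h1 : ∀ᵐ p ∂lam, p ∉ {x | x ∈ Ioo 0 1 ∧ ¬ContinuousWithinAt w (Ioo 0 1) x} :=
    hcount.ae_notMem _
  filter_upwards [h1, ae_restrict_mem measurableSet_Ioo] with p hp hpI
  have hc : ContinuousWithinAt w (Ioo 0 1) p := by
    by_contra h; exact hp ⟨hpI, h⟩
  have hc' : ContinuousAt w p := hc.continuousAt (Ioo_mem_nhds hpI.1 hpI.2)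
  apply le_antisymm (hle p hpI)
  have ht : Filter.Tendsto w (nhdsWithin p (Iio p)) (nhds (w p)) :=
    hc'.tendsto.mono_left nhdsWithin_le_nhds
  refine le_of_tendsto ht ?_
  filter_upwards [self_mem_nhdsWithin, Ioo_mem_nhdsLT hpI.1] with r hr hr2
  exact hge p hpI r ⟨hr2.1, hr2.2.trans hpI.2⟩ hr

/-- support line of the integral of a monotone function -/
lemma support_int {v : ℝ → ℝ} (hv : MonotoneOn v (Ioo 0 1)) (hi : Integrable v lam)
    {c x : ℝ} (hc : c ∈ Ioo (0:ℝ) 1) (hx : x ∈ Icc (0:ℝ) 1) :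
    (∫ p in (0:ℝ)..c, v p) + v c * (x - c) ≤ ∫ p in (0:ℝ)..x, v p := by
  have h0 : (0:ℝ) ∈ Icc (0:ℝ) 1 := by simp
  have hcI : c ∈ Icc (0:ℝ) 1 := ⟨hc.1.le, hc.2.le⟩
  have e := intervalIntegral.integral_add_adjacent_intervals (lam_ivl' hi h0 hcI) (lam_ivl' hi hcI hx)
  rw [← e]
  have : v c * (x - c) ≤ ∫ p in c..x, v p := by
    rcases le_total c x with h | h
    · have h2 : ∫ p in c..x, v c ≤ ∫ p in c..x, v p := by
        apply intervalIntegral.integral_mono_on_of_le_Ioo h (by simp) (lam_ivl' hi hcI hx)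
        intro p hp
        exact hv hc ⟨hc.1.trans hp.1, hp.2.trans_le hx.2⟩ hp.1.le
      simp at h2; linarith
    · have h2 : ∫ p in x..c, v p ≤ ∫ p in x..c, v c := by
        apply intervalIntegral.integral_mono_on_of_le_Ioo h (lam_ivl' hi hx hcI) (by simp)
        intro p hp
        exact hv ⟨hx.1.trans_lt hp.1, hp.2.trans hc.2⟩ hc hp.2.le
      rw [intervalIntegral.integral_symm]
      simp at h2; linarith
  linarith

lemma cont_int {v : ℝ → ℝ} (hi : Integrable v lam) :
    ContinuousOn (fun q => ∫ p in (0:ℝ)..q, v p) (Icc 0 1) := by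
  have h := intervalIntegral.continuousOn_primitive_interval (μ := volume) (f := v) (a := 0) (b := 1)
    (by
      rw [uIcc_of_le zero_le_one, integrableOn_Icc_iff_integrableOn_Ioo]
      exact hi)
  rwa [uIcc_of_le zero_le_one] at h

lemma convexOn_of_local_support {Θ : ℝ → ℝ} (hc : ContinuousOn Θ (Icc 0 1))
    (hs : ∀ c ∈ Ioo (0:ℝ) 1, ∃ m : ℝ, ∀ᶠ x in nhds c, Θ c + m * (x - c) ≤ Θ x) :
    ConvexOn ℝ (Icc 0 1) Θ := by
  refine LinearOrder.convexOn_of_lt (convex_Icc 0 1) ?_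
  intro x hx y hy hxy a b ha hb hab
  simp only [smul_eq_mul]
  by_contra hlt
  push Not at hlt
  set z := a * x + b * y with hz
  have hyx : 0 < y - x := sub_pos.2 hxy
  set m := (Θ y - Θ x) / (y - x) with hm
  have hm' : m * (y - x) = Θ y - Θ x := by rw [hm]; field_simp
  set D : ℝ → ℝ := fun t => Θ t - Θ x - m * (t - x) with hD
  have hDx : D x = 0 := by simp [hD]
  have hDy : D y = 0 := by simp only [hD]; linarith
  have hzx : z - x = b * (y - x) := by rw [hz]; have : a = 1 - b := by linarith
                                       rw [this]; ring
  have hzI : z ∈ Icc x y := by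
    constructor
    · nlinarith
    · have : y - z = a * (y - x) := by rw [hz]; have : b = 1 - a := by linarith
                                       rw [this]; ring
      nlinarith
  have hDz : 0 < D z := by
    simp only [hD]
    rw [hzx]
    have : m * (b * (y - x)) = b * (Θ y - Θ x) := by rw [← hm']; ring
    rw [this]
    have : a = 1 - b := by linarith
    rw [this] at hlt
    linarith
  have hDc : ContinuousOn D (Icc x y) := by
    have : ContinuousOn Θ (Icc x y) := hc.mono (Icc_subset_Icc hx.1 hy.2)
    fun_prop
  obtain ⟨M, hMI, hM⟩ := isCompact_Icc.exists_isMaxOn (nonempty_Icc.2 hxy.le) hDc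
  set K := Icc x y ∩ D ⁻¹' (Ici (D M)) with hK
  have hKcl : IsClosed K := hDc.preimage_isClosed_of_isClosed isClosed_Icc isClosed_Ici
  have hKc : IsCompact K := isCompact_Icc.of_isClosed_subset hKcl inter_subset_left
  have hKne : K.Nonempty := ⟨M, hMI, le_refl (D M)⟩
  obtain ⟨c, hcK, hcl⟩ := hKc.exists_isLeast hKne
  have hDcpos : 0 < D c := hDz.trans_le ((hM hzI).trans hcK.2)
  have hcx : x < c := lt_of_le_of_ne hcK.1.1 (by rintro rfl; linarith)
  have hcy : c < y := lt_of_le_of_ne hcK.1.2 (by rintro rfl; linarith)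
  obtain ⟨s, hsupp⟩ := hs c ⟨hx.1.trans_lt hcx, hcy.trans_le hy.2⟩
  have hev := hsupp.and (Ioo_mem_nhds hcx hcy)
  obtain ⟨ε, hε, hball⟩ := Metric.eventually_nhds_iff.1 hev
  have h1 := hball (y := c + ε / 2) (by simp [Real.dist_eq, abs_of_pos hε]; linarith)
  have h2 := hball (y := c - ε / 2) (by simp [Real.dist_eq, abs_of_pos hε]; linarith)
  have h1M : D (c + ε/2) ≤ D c := (hM (Ioo_subset_Icc_self h1.2)).trans hcK.2
  have hsm : s ≤ m := by
    simp only [hD] at h1M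
    nlinarith [h1.1]
  have : c - ε / 2 ∈ K := by
    refine ⟨Ioo_subset_Icc_self h2.2, ?_⟩
    have : D M ≤ D c := hcK.2
    refine this.trans ?_
    simp only [hD]
    nlinarith [h2.1]
  have := hcl this
  linarith

lemma exists_cone {G : ℝ → ℝ} (hG : ContinuousOn G (Icc 0 1)) {e : ℝ} (he : e ∈ Icc (0:ℝ) 1)
    {ε : ℝ} (hε : 0 < ε) : ∃ K : ℝ, 0 ≤ K ∧ ∀ q ∈ Icc (0:ℝ) 1, G e - ε - K * |q - e| ≤ G q := by
  obtain ⟨δ, hδ, h⟩ := Metric.continuousWithinAt_iff.1 (hG e he) ε hε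
  obtain ⟨B, hBI, hB⟩ := isCompact_Icc.exists_isMinOn (nonempty_Icc.2 (zero_le_one' ℝ)) hG
  refine ⟨|G e - G B| / δ, by positivity, fun q hq => ?_⟩
  rcases lt_or_ge |q - e| δ with h1 | h1
  · have := h hq (by rwa [Real.dist_eq])
    rw [Real.dist_eq, abs_lt] at this
    have : 0 ≤ |G e - G B| / δ * |q - e| := by positivity
    linarith
  · have h2 : |G e - G B| ≤ |G e - G B| / δ * |q - e| := by
      rw [div_mul_eq_mul_div, le_div_iff₀ hδ]
      exact mul_le_mul_of_nonneg_left h1 (abs_nonneg _)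
    have h3 := hB hq
    have h3 : G B ≤ G q := h3
    have := le_abs_self (G e - G B)
    linarith

lemma hull_props {G ψ : ℝ → ℝ} (hG : ContinuousOn G (Icc 0 1))
    (hψconv : ConvexOn ℝ (Icc 0 1) ψ)
    (hψle : ∀ q ∈ Icc (0:ℝ) 1, ψ q ≤ G q)
    (hψmax : ∀ χ : ℝ → ℝ, ConvexOn ℝ (Icc 0 1) χ → (∀ q ∈ Icc (0:ℝ) 1, χ q ≤ G q) →
        ∀ q ∈ Icc (0:ℝ) 1, χ q ≤ ψ q) :
    ψ 0 = G 0 ∧ ψ 1 = G 1 ∧ ContinuousOn ψ (Icc 0 1) := by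
  have aff : ∀ α β : ℝ, ConvexOn ℝ (Icc 0 1) (fun q : ℝ => α + β * q) := by
    intro α β
    refine ⟨convex_Icc 0 1, fun x _ y _ a b _ _ hab => ?_⟩
    simp only [smul_eq_mul]
    have : a = 1 - b := by linarith
    rw [this]; apply le_of_eq; ring
  have cone : ∀ e : ℝ, (e = 0 ∨ e = 1) → ∀ ε > 0, ∃ K : ℝ, 0 ≤ K ∧ ∀ q ∈ Icc (0:ℝ) 1,
      G e - ε - K * |q - e| ≤ ψ q := by
    intro e he ε hε
    have heI : e ∈ Icc (0:ℝ) 1 := by rcases he with rfl | rfl <;> simp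
    obtain ⟨K, hK, h⟩ := exists_cone hG heI hε
    refine ⟨K, hK, ?_⟩
    rcases he with rfl | rfl
    · intro q hq
      have := hψmax _ (aff (G 0 - ε) (-K)) (fun r hr => by
        have := h r hr; rw [sub_zero, abs_of_nonneg hr.1] at this; linarith) q hq
      rw [sub_zero, abs_of_nonneg hq.1]; linarith
    · intro q hq
      have := hψmax _ (aff (G 1 - ε - K) (K)) (fun r hr => by
        have := h r hr; rw [abs_of_nonpos (by linarith [hr.2])] at this; linarith) q hq
      rw [abs_of_nonpos (by linarith [hq.2])]; linarith
  have ends : ∀ e : ℝ, (e = 0 ∨ e = 1) → ψ e = G e := by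
    intro e he
    have heI : e ∈ Icc (0:ℝ) 1 := by rcases he with rfl | rfl <;> simp
    apply le_antisymm (hψle e heI)
    refine le_of_forall_pos_le_add fun ε hε => ?_
    obtain ⟨K, hK, h⟩ := cone e he ε hε
    have := h e heI
    simp at this; linarith
  have conte : ∀ e : ℝ, (e = 0 ∨ e = 1) → ContinuousWithinAt ψ (Icc 0 1) e := by
    intro e he
    have heI : e ∈ Icc (0:ℝ) 1 := by rcases he with rfl | rfl <;> simp
    rw [Metric.continuousWithinAt_iff]
    intro ε hε
    obtain ⟨K, hK, h⟩ := cone e he (ε / 2) (by positivity)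
    obtain ⟨δ, hδ, h'⟩ := Metric.continuousWithinAt_iff.1 (hG e heI) ε hε
    refine ⟨min δ (ε / (2 * (K + 1))), by positivity, fun q hq hd => ?_⟩
    rw [lt_min_iff, lt_div_iff₀ (by positivity)] at hd
    have h1 := h' hq hd.1
    have h2 := h q hq
    have h3 := hψle q hq
    rw [Real.dist_eq] at *
    rw [ends e he]
    rw [abs_lt] at h1 ⊢
    have h4 : 0 ≤ |q - e| := abs_nonneg _
    constructor
    · nlinarith [hd.2]
    · linarith
  refine ⟨ends 0 (Or.inl rfl), ends 1 (Or.inr rfl), ?_⟩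
  have hint := hψconv.continuousOn_interior
  rw [interior_Icc] at hint
  intro q hq
  rcases eq_or_lt_of_le hq.1 with h | h
  · exact conte q (Or.inl h.symm)
  rcases eq_or_lt_of_le hq.2 with h' | h'
  · exact conte q (Or.inr h')
  exact ((hint q ⟨h, h'⟩).continuousAt (Ioo_mem_nhds h h')).continuousWithinAt

lemma hull_affine {G ψ : ℝ → ℝ} (hG : ContinuousOn G (Icc 0 1))
    (hψconv : ConvexOn ℝ (Icc 0 1) ψ)
    (hψle : ∀ q ∈ Icc (0:ℝ) 1, ψ q ≤ G q)
    (hψmax : ∀ χ : ℝ → ℝ, ConvexOn ℝ (Icc 0 1) χ → (∀ q ∈ Icc (0:ℝ) 1, χ q ≤ G q) →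
        ∀ q ∈ Icc (0:ℝ) 1, χ q ≤ ψ q) {c : ℝ} (hc : c ∈ Ioo (0:ℝ) 1) (hlt : ψ c < G c) :
    ∃ α β : ℝ, ∀ᶠ x in nhds c, ψ x = α + β * x := by
  have aff : ∀ α β : ℝ, ConvexOn ℝ (Icc 0 1) (fun q : ℝ => α + β * q) := by
    intro α β
    refine ⟨convex_Icc 0 1, fun x _ y _ a b _ _ hab => ?_⟩
    simp only [smul_eq_mul]
    have : a = 1 - b := by linarith
    rw [this]; apply le_of_eq; ring
  have hcψ : ContinuousAt ψ c := by
    have hint := hψconv.continuousOn_interior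
    rw [interior_Icc] at hint
    exact (hint c hc).continuousAt (Ioo_mem_nhds hc.1 hc.2)
  have hcG : ContinuousAt G c := (hG c (Ioo_subset_Icc_self hc)).continuousAt
    (Icc_mem_nhds hc.1 hc.2)
  set m := (ψ c + G c) / 2 with hm
  have e1 : ∀ᶠ x in nhds c, ψ x < m := hcψ.eventually (gt_mem_nhds (by linarith))
  have e2 : ∀ᶠ x in nhds c, m < G x := hcG.eventually (lt_mem_nhds (by linarith))
  obtain ⟨ε, hε, hb⟩ := Metric.eventually_nhds_iff.1 ((e1.and e2).and (Ioo_mem_nhds hc.1 hc.2))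
  set a := c - ε / 2
  set b := c + ε / 2
  have hab : a < b := by simp only [a, b]; linarith
  have hin : ∀ x ∈ Icc a b, ψ x < m ∧ m < G x ∧ x ∈ Ioo (0:ℝ) 1 := by
    intro x hx
    have := hb (y := x) (by
      rw [Real.dist_eq, abs_lt]; constructor <;> simp only [a, b, mem_Icc] at hx <;> linarith)
    exact ⟨this.1.1, this.1.2, this.2⟩
  have ha := hin a ⟨le_rfl, hab.le⟩
  have hbb := hin b ⟨hab.le, le_rfl⟩
  have haI := Ioo_subset_Icc_self ha.2.2
  have hbI := Ioo_subset_Icc_self hbb.2.2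
  set β := (ψ b - ψ a) / (b - a) with hβ
  have hβ' : β * (b - a) = ψ b - ψ a := by rw [hβ]; field_simp [sub_ne_zero.2 hab.ne']
  set α := ψ a - β * a with hα
  have hba : 0 < b - a := sub_pos.2 hab
  have hmax := hψmax (ψ ⊔ fun q => α + β * q) (hψconv.sup (aff α β)) (by
    intro q hq
    refine sup_le (hψle q hq) ?_
    show α + β * q ≤ G q
    rcases lt_or_ge q a with h1 | h1
    · -- left of a
      refine le_trans ?_ (hψle q hq)
      have := hψconv.slope_mono_adjacent hq hbI h1 hab
      rw [div_le_iff₀ (sub_pos.2 h1)] at this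
      have e : (ψ b - ψ a) / (b - a) = β := rfl
      rw [e] at this
      rw [hα]; linarith
    rcases lt_or_ge b q with h2 | h2
    · refine le_trans ?_ (hψle q hq)
      have := hψconv.slope_mono_adjacent haI hq hab h2
      rw [le_div_iff₀ (sub_pos.2 h2)] at this
      have e : (ψ b - ψ a) / (b - a) = β := rfl
      rw [e] at this
      rw [hα]; linarith
    · refine le_trans ?_ (hin q ⟨h1, h2⟩).2.1.le
      have hbm := hbb.1
      have ham := ha.1
      rw [hα]
      have h3 : (b - a) * (ψ a - β * a + β * q) = (b - q) * ψ a + (q - a) * ψ b := by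
        have : ψ b = ψ a + β * (b - a) := by linarith
        rw [this]; ring
      have h4 : (b - q) * ψ a + (q - a) * ψ b ≤ (b - a) * m := by nlinarith
      rw [← h3] at h4
      exact le_of_mul_le_mul_left h4 hba)
  refine ⟨α, β, ?_⟩
  filter_upwards [Icc_mem_nhds (show a < c by simp only [a]; linarith)
    (show c < b by simp only [b]; linarith)] with x hx
  apply le_antisymm
  · rcases eq_or_lt_of_le hx.1 with h | h
    · rw [← h, hα]; linarith
    rcases eq_or_lt_of_le hx.2 with h' | h'
    · rw [h', hα]; linarith
    have h3 := hψconv.secant_mono_aux1 haI hbI h h'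
    have hl : (b - a) * (α + β * x) = (b - x) * ψ a + (x - a) * ψ b := by
      have : ψ b = ψ a + β * (b - a) := by linarith
      rw [this, hα]; ring
    have h4 : (b - a) * ψ x ≤ (b - a) * (α + β * x) := by rw [hl]; exact h3
    exact le_of_mul_le_mul_left h4 hba
  · exact le_trans le_sup_right (hmax x (Ioo_subset_Icc_self (hin x hx).2.2))

/-- right derivative -/
def rd (f : ℝ → ℝ) (x : ℝ) : ℝ := derivWithin f (Ioi x) x

lemma rd_mono {f : ℝ → ℝ} (hf : ConvexOn ℝ (Icc 0 1) f) : MonotoneOn (rd f) (Ioo 0 1) := by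
  have := hf.monotoneOn_rightDeriv
  rwa [interior_Icc] at this

lemma rd_has {f : ℝ → ℝ} (hf : ConvexOn ℝ (Icc 0 1) f) {x : ℝ} (hx : x ∈ Ioo (0:ℝ) 1) :
    HasDerivWithinAt f (rd f x) (Ioi x) x :=
  hf.hasDerivWithinAt_rightDeriv_of_mem_interior (by rwa [interior_Icc])

lemma rd_integrable {f : ℝ → ℝ} (hf : ConvexOn ℝ (Icc 0 1) f) (hc : ContinuousOn f (Icc 0 1)) :
    Integrable (rd f) lam := by
  have hmid : (1/2 : ℝ) ∈ Ioo (0:ℝ) 1 := by norm_num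
  set k := rd f (1/2) with hk
  have h1 : IntegrableOn (fun x => rd f x - k) (Ioc (1/2) 1) := by
    apply intervalIntegral.integrableOn_deriv_right_of_nonneg (g := fun x => f x - k * x)
    · have : ContinuousOn f (Icc (1/2) 1) := hc.mono (Icc_subset_Icc (by norm_num) le_rfl)
      fun_prop
    · intro x hx
      have := (rd_has hf (x := x) ⟨by linarith [hx.1], hx.2⟩).sub
        ((hasDerivWithinAt_id x (Ioi x)).const_mul k)
      rw [mul_one] at this
      exact this
    · intro x hx
      have := rd_mono hf hmid (show x ∈ Ioo (0:ℝ) 1 from ⟨by linarith [hx.1], hx.2⟩) hx.1.le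
      linarith
  have h2 : IntegrableOn (fun x => k - rd f x) (Ioc 0 (1/2)) := by
    apply intervalIntegral.integrableOn_deriv_right_of_nonneg (g := fun x => k * x - f x)
    · have : ContinuousOn f (Icc 0 (1/2)) := hc.mono (Icc_subset_Icc le_rfl (by norm_num))
      fun_prop
    · intro x hx
      have := ((hasDerivWithinAt_id x (Ioi x)).const_mul k).sub
        (rd_has hf (x := x) ⟨hx.1, by linarith [hx.2]⟩)
      rw [mul_one] at this
      exact this
    · intro x hx
      have := rd_mono hf (show x ∈ Ioo (0:ℝ) 1 from ⟨hx.1, by linarith [hx.2]⟩) hmid hx.2.le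
      linarith
  have h1' : IntegrableOn (rd f) (Ioc (1/2) 1) := by
    have := h1.add (integrableOn_const (C := k) (by simp) (by simp))
    refine this.congr_fun (fun x _ => ?_) measurableSet_Ioc
    simp
  have h2' : IntegrableOn (rd f) (Ioc 0 (1/2)) := by
    have := (integrableOn_const (C := k) (by simp) (by simp)).sub h2
    refine this.congr_fun (fun x _ => ?_) measurableSet_Ioc
    simp
  have h3 := h2'.union h1'
  rw [Ioc_union_Ioc_eq_Ioc (by norm_num) (by norm_num)] at h3
  exact h3.mono_set Ioo_subset_Ioc_self

lemma rd_integral {f : ℝ → ℝ} (hf : ConvexOn ℝ (Icc 0 1) f) (hc : ContinuousOn f (Icc 0 1))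
    {a b : ℝ} (ha : 0 ≤ a) (hab : a ≤ b) (hb : b ≤ 1) :
    ∫ p in a..b, rd f p = f b - f a := by
  apply intervalIntegral.integral_eq_sub_of_hasDeriv_right_of_le hab
  · exact hc.mono (Icc_subset_Icc ha hb)
  · intro x hx
    exact rd_has hf ⟨ha.trans_lt hx.1, hx.2.trans_le hb⟩
  · exact lam_ivl' (rd_integrable hf hc) ⟨ha, hab.trans hb⟩ ⟨ha.trans hab, hb⟩

/-- layer cake kernel -/
def Jk (t y : ℝ) : ℝ := (if t < y then 1 else 0) - (if t < 0 then 1 else 0)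

lemma Jk_eq (y : ℝ) : (fun t => Jk t y) =
    fun t => (Ico 0 y).indicator (fun _ => (1:ℝ)) t - (Ico y 0).indicator (fun _ => (1:ℝ)) t := by
  funext t
  simp only [Jk, indicator, mem_Ico]
  grind

lemma Jk_abs_eq (y : ℝ) : (fun t => |Jk t y|) =
    fun t => (Ico 0 y).indicator (fun _ => (1:ℝ)) t + (Ico y 0).indicator (fun _ => (1:ℝ)) t := by
  funext t
  simp only [Jk, indicator, mem_Ico]
  grind

lemma ind_int (a b : ℝ) : Integrable ((Ico a b).indicator (fun _ => (1:ℝ))) :=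
  (integrable_indicator_iff measurableSet_Ico).2 (integrableOn_const (by simp) (by simp))

lemma Jk_int (y : ℝ) : Integrable (fun t => Jk t y) := by
  rw [Jk_eq]; exact (ind_int _ _).sub (ind_int _ _)

lemma Jk_integral (y : ℝ) : ∫ t, Jk t y = y := by
  rw [Jk_eq, integral_sub (ind_int _ _) (ind_int _ _), integral_indicator measurableSet_Ico,
    integral_indicator measurableSet_Ico]
  simp [max_def]
  grind

lemma Jk_abs_integral (y : ℝ) : ∫ t, |Jk t y| = |y| := by
  rw [Jk_abs_eq, integral_add (ind_int _ _) (ind_int _ _), integral_indicator measurableSet_Ico,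
    integral_indicator measurableSet_Ico]
  simp [max_def]
  grind

lemma layer_cake_meas {Ω : Type*} [MeasurableSpace Ω] (P : Measure Ω) [IsFiniteMeasure P]
    {g k : Ω → ℝ} (hg : Measurable g) (hk : Integrable k P) (hgk : Integrable (fun ω => g ω * k ω) P)
    (h0 : ∫ ω, k ω ∂P = 0) (ht : ∀ t : ℝ, 0 ≤ ∫ ω in {ω | t < g ω}, k ω ∂P) :
    0 ≤ ∫ ω, g ω * k ω ∂P := by
  have hJm : Measurable fun z : Ω × ℝ => Jk z.2 (g z.1) := by
    unfold Jk
    apply Measurable.sub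
    · exact Measurable.ite (measurableSet_lt measurable_snd (hg.comp measurable_fst))
        measurable_const measurable_const
    · exact Measurable.ite (measurableSet_lt measurable_snd measurable_const)
        measurable_const measurable_const
  have hmeas : AEStronglyMeasurable (fun z : Ω × ℝ => Jk z.2 (g z.1) * k z.1) (P.prod volume) :=
    hJm.aestronglyMeasurable.mul hk.aestronglyMeasurable.comp_fst
  have hint : Integrable (fun z : Ω × ℝ => Jk z.2 (g z.1) * k z.1) (P.prod volume) := by
    rw [integrable_prod_iff hmeas]
    constructor
    · exact Filter.Eventually.of_forall fun ω => (Jk_int (g ω)).mul_const (k ω)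
    · have : (fun ω => ∫ t, ‖Jk t (g ω) * k ω‖) = fun ω => ‖g ω * k ω‖ := by
        funext ω
        simp only [norm_mul, Real.norm_eq_abs]
        rw [integral_mul_const, Jk_abs_integral]
      simp only []
      rw [this]
      exact hgk.norm
  have e1 : ∫ ω, g ω * k ω ∂P = ∫ ω, (∫ t, Jk t (g ω) * k ω) ∂P := by
    congr 1; funext ω
    rw [integral_mul_const, Jk_integral]
  rw [e1, integral_integral_swap hint]
  apply integral_nonneg
  intro t
  have e2 : (fun ω => Jk t (g ω) * k ω) =
      fun ω => {ω | t < g ω}.indicator k ω - (if t < 0 then 1 else 0) * k ω := by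
    funext ω
    simp only [Jk, indicator, mem_ofPred_eq]
    split_ifs <;> ring
  have hms : MeasurableSet {ω | t < g ω} := measurableSet_lt measurable_const hg
  simp only [Pi.zero_apply]
  rw [e2, integral_sub (hk.indicator hms) (hk.const_mul _), integral_const_mul, h0,
    integral_indicator hms]
  simpa using ht t

lemma layer_cake {Ω : Type*} [MeasurableSpace Ω] (P : Measure Ω) [IsFiniteMeasure P]
    {g k : Ω → ℝ} (hg : AEMeasurable g P) (hk : Integrable k P)
    (hgk : Integrable (fun ω => g ω * k ω) P)
    (h0 : ∫ ω, k ω ∂P = 0) (ht : ∀ t : ℝ, 0 ≤ ∫ ω in {ω | t < g ω}, k ω ∂P) :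
    0 ≤ ∫ ω, g ω * k ω ∂P := by
  have he := hg.ae_eq_mk
  have he2 : (fun ω => g ω * k ω) =ᵐ[P] fun ω => hg.mk g ω * k ω := by
    filter_upwards [he] with ω h; rw [h]
  rw [integral_congr_ae he2]
  refine layer_cake_meas P hg.measurable_mk hk (hgk.congr he2) h0 fun t => ?_
  have : P.restrict {ω | t < hg.mk g ω} = P.restrict {ω | t < g ω} := by
    apply Measure.restrict_congr_set
    rw [Filter.eventuallyEq_set]
    filter_upwards [he] with ω h
    simp [h]
  rw [this]
  exact ht t

lemma upper_level {g : ℝ → ℝ} (hg : MonotoneOn g (Ioo 0 1)) (t : ℝ) :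
    ∃ a ∈ Icc (0:ℝ) 1, (∀ p ∈ Ioo a 1, t < g p) ∧ (∀ p ∈ Ioo (0:ℝ) 1, p < a → g p ≤ t) ∧
      lam.restrict {p | t < g p} = volume.restrict (Ioo a 1) := by
  set A := {p | t < g p} ∩ Ioo 0 1 with hA
  have key : ∃ a ∈ Icc (0:ℝ) 1, (∀ p ∈ Ioo a 1, t < g p) ∧ (∀ p ∈ Ioo (0:ℝ) 1, p < a → g p ≤ t) := by
    rcases A.eq_empty_or_nonempty with h | h
    · refine ⟨1, by simp, by simp, fun p hp _ => ?_⟩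
      by_contra hlt
      have : p ∈ A := ⟨not_le.1 hlt, hp⟩
      rw [h] at this; exact this
    · have hb : BddBelow A := ⟨0, fun p hp => hp.2.1.le⟩
      obtain ⟨z, hz⟩ := h
      refine ⟨sInf A, ⟨le_csInf ⟨z, hz⟩ fun p hp => hp.2.1.le,
        (csInf_le hb hz).trans hz.2.2.le⟩, ?_, ?_⟩
      · intro p hp
        obtain ⟨r, hr, hrp⟩ := exists_lt_of_csInf_lt ⟨z, hz⟩ hp.1
        have : t < g r := hr.1
        exact this.trans_le (hg hr.2 ⟨hr.2.1.trans hrp, hp.2⟩ hrp.le)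
      · intro p hp hpa
        by_contra hlt
        exact absurd (csInf_le hb (show p ∈ A from ⟨not_le.1 hlt, hp⟩)) (not_le.2 hpa)
  obtain ⟨a, ha, h1, h2⟩ := key
  refine ⟨a, ha, h1, h2, ?_⟩
  rw [Measure.restrict_restrict' measurableSet_Ioo]
  apply Measure.restrict_congr_set
  rw [Filter.eventuallyEq_set]
  have hne : ∀ᵐ p : ℝ, p ≠ a := by simp [ae_iff]
  filter_upwards [hne] with p hp
  constructor
  · rintro ⟨hp1, hp2⟩
    refine ⟨lt_of_le_of_ne ?_ hp.symm, hp2.2⟩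
    by_contra hlt
    exact absurd (h2 p hp2 (not_le.1 hlt)) (not_le.2 hp1)
  · intro hpp
    exact ⟨h1 p hpp, ha.1.trans_lt hpp.1, hpp.2⟩

lemma Ioo_int {f : ℝ → ℝ} {a : ℝ} (ha : a ≤ 1) : ∫ p in Ioo a 1, f p = ∫ p in a..1, f p := by
  rw [intervalIntegral.integral_of_le ha, integral_Ioc_eq_integral_Ioo]

lemma subgrad {φ : ℝ → ℝ} (hφ : ConvexOn ℝ univ φ) :
    ∃ f : ℝ → ℝ, Monotone f ∧ ∀ x y, φ x + f x * (y - x) ≤ φ y := by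
  have hi : ∀ x : ℝ, x ∈ interior (univ : Set ℝ) := fun x => by simp
  have h : ∀ x y, φ x + derivWithin φ (Ioi x) x * (y - x) ≤ φ y := by
    intro x y
    rcases lt_trichotomy x y with hxy | rfl | hxy
    · have := hφ.rightDeriv_le_slope_of_mem_interior (hi x) (mem_univ y) hxy
      rw [slope_def_field, le_div_iff₀ (sub_pos.2 hxy)] at this
      linarith
    · simp
    · have h1 := hφ.slope_le_leftDeriv_of_mem_interior (mem_univ y) (hi x) hxy
      have h2 := hφ.leftDeriv_le_rightDeriv_of_mem_interior (hi x)
      have := h1.trans h2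
      rw [slope_def_field, div_le_iff₀ (sub_pos.2 hxy)] at this
      linarith
  refine ⟨_, ?_, h⟩
  intro x y hxy
  rcases eq_or_lt_of_le hxy with rfl | hlt
  · exact le_rfl
  have h1 := h x y
  have h2 := h y x
  simp only []
  by_contra hc
  push Not at hc
  nlinarith [mul_pos (sub_pos.2 hc) (sub_pos.2 hlt)]

/-- clamp -/
def clp (n : ℝ) (x : ℝ) : ℝ := max (-n) (min n x)

lemma clp_mono (n : ℝ) : Monotone (clp n) := fun a b h => by
  unfold clp; exact max_le_max le_rfl (min_le_min le_rfl h)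

lemma clp_mem {n : ℝ} (hn : 0 ≤ n) (x : ℝ) : clp n x ∈ Icc (-n) n := by
  unfold clp
  exact ⟨le_max_left _ _, max_le (by linarith) (min_le_left _ _)⟩

lemma clp_of_mem {n x : ℝ} (hx : x ∈ Icc (-n) n) : clp n x = x := by
  unfold clp; rw [min_eq_right hx.2, max_eq_right hx.1]

/-- affine extension of a convex function -/
def aext (φ f : ℝ → ℝ) (n x : ℝ) : ℝ := φ (clp n x) + f (clp n x) * (x - clp n x)

lemma aext_tangent {φ f : ℝ → ℝ} (hf : Monotone f) (h : ∀ x y, φ x + f x * (y - x) ≤ φ y)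
    {n : ℝ} (hn : 0 ≤ n) {y : ℝ} (hy : y ∈ Icc (-n) n) (b : ℝ) :
    φ y + f y * (b - y) ≤ aext φ f n b := by
  unfold aext
  have h1 := h y (clp n b)
  have h2 : f y * (b - clp n b) ≤ f (clp n b) * (b - clp n b) := by
    rcases lt_trichotomy b (clp n b) with hlt | heq | hlt
    · have : clp n b = -n := by
        unfold clp at *
        rcases max_cases (-n) (min n b) with h | h
        · exact h.1
        · rw [h.1] at hlt; exact absurd (min_le_right n b) (not_le.2 hlt)
      have : f (clp n b) ≤ f y := hf (by rw [this]; exact hy.1)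
      nlinarith
    · rw [← heq]; simp
    · have : clp n b = n := by
        unfold clp at *
        rcases min_cases n b with h | h
        · rw [h.1]; exact max_eq_right (by linarith)
        · rw [h.1] at hlt; exact absurd (le_max_right (-n) b) (not_le.2 hlt)
      have : f y ≤ f (clp n b) := hf (by rw [this]; exact hy.2)
      nlinarith
  linarith

lemma aext_bound {φ f : ℝ → ℝ} (hf : Monotone f) (h : ∀ x y, φ x + f x * (y - x) ≤ φ y)
    {n : ℝ} (hn : 0 ≤ n) (b : ℝ) :
    |aext φ f n b| ≤ |φ 0| + (|f n| + |f (-n)|) * |b| := by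
  have h0 : (0:ℝ) ∈ Icc (-n) n := ⟨by linarith, hn⟩
  have l1 := aext_tangent hf h hn h0 b
  have l2 := aext_tangent hf h hn (clp_mem hn b) 0
  have e0 : aext φ f n 0 = φ 0 := by unfold aext; rw [clp_of_mem h0]; simp
  have u : aext φ f n b ≤ φ 0 + f (clp n b) * b := by
    rw [e0] at l2
    unfold aext; linarith
  have fb : ∀ y ∈ Icc (-n) n, |f y| ≤ |f n| + |f (-n)| := by
    intro y hy
    have h1 := hf hy.1
    have h2 := hf hy.2
    rw [abs_le]
    constructor
    · have := neg_abs_le (f (-n)); have := abs_nonneg (f n); linarith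
    · have := le_abs_self (f n); have := abs_nonneg (f (-n)); linarith
  have m1 : |f 0 * b| ≤ (|f n| + |f (-n)|) * |b| := by
    rw [abs_mul]; exact mul_le_mul_of_nonneg_right (fb 0 h0) (abs_nonneg _)
  have m2 : |f (clp n b) * b| ≤ (|f n| + |f (-n)|) * |b| := by
    rw [abs_mul]; exact mul_le_mul_of_nonneg_right (fb _ (clp_mem hn b)) (abs_nonneg _)
  rw [abs_le] at *
  have := neg_abs_le (φ 0)
  have := le_abs_self (φ 0)
  constructor
  · linarith [m1.1]
  · linarith [m2.2]

lemma cx_core {w v : ℝ → ℝ} (hw : MonotoneOn w (Ioo 0 1)) (hv : MonotoneOn v (Ioo 0 1))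
    (iw : Integrable w lam) (iv : Integrable v lam)
    (hle : ∀ a ∈ Icc (0:ℝ) 1, ∫ p in a..1, w p ≤ ∫ p in a..1, v p)
    (heq : ∫ p, w p ∂lam = ∫ p, v p ∂lam)
    {φ f : ℝ → ℝ} (hφ : Continuous φ) (hf : Monotone f) (h : ∀ x y, φ x + f x * (y - x) ≤ φ y) :
    ∫⁻ p, ENNReal.ofReal (φ (w p) - (φ 0 + f 0 * w p)) ∂lam ≤
      ∫⁻ p, ENNReal.ofReal (φ (v p) - (φ 0 + f 0 * v p)) ∂lam := by
  have mw := aemeas_mono hw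
  have mv := aemeas_mono hv
  have maext : ∀ n, Measurable (aext φ f n) := by
    intro n
    have : Measurable (clp n) := (clp_mono n).measurable
    have h2 := hf.measurable
    have h3 := hφ.measurable
    unfold aext; fun_prop
  have iaext : ∀ n, 0 ≤ n → ∀ u : ℝ → ℝ, Integrable u lam →
      Integrable (fun p => aext φ f n (u p)) lam := by
    intro n hn u hu
    have hb : Integrable (fun p => |φ 0| + (|f n| + |f (-n)|) * |u p|) lam :=
      (integrable_const _).add (hu.abs.const_mul _)
    refine hb.mono' ((maext n).comp_aemeasurable hu.aemeasurable).aestronglyMeasurable ?_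
    exact Filter.Eventually.of_forall fun p => aext_bound hf h hn (u p)
  have il : ∀ u : ℝ → ℝ, Integrable u lam → Integrable (fun p => φ 0 + f 0 * u p) lam :=
    fun u hu => (integrable_const _).add (hu.const_mul _)
  have h0n : ∀ n : ℝ, 0 ≤ n → (0:ℝ) ∈ Icc (-n) n := fun n hn => ⟨by linarith, hn⟩
  -- comparison for the truncated functions
  have step : ∀ n : ℝ, 0 ≤ n → ∫ p, aext φ f n (w p) ∂lam ≤ ∫ p, aext φ f n (v p) ∂lam := by
    intro n hn
    set g : ℝ → ℝ := fun p => f (clp n (w p)) with hg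
    have gm : MonotoneOn g (Ioo 0 1) := fun a ha b hb hab => hf (clp_mono n (hw ha hb hab))
    have ik : Integrable (fun p => v p - w p) lam := iv.sub iw
    have igk : Integrable (fun p => g p * (v p - w p)) lam := by
      refine (ik.abs.const_mul (|f n| + |f (-n)|)).mono'
        ((aemeas_mono gm).mul ik.aemeasurable).aestronglyMeasurable ?_
      refine Filter.Eventually.of_forall fun p => ?_
      rw [Real.norm_eq_abs, abs_mul]
      refine mul_le_mul_of_nonneg_right ?_ (abs_nonneg _)
      have hy := clp_mem hn (w p)
      have h1 := hf hy.1
      have h2 := hf hy.2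
      rw [abs_le]
      constructor
      · have := neg_abs_le (f (-n)); have := abs_nonneg (f n); simp only [hg]; linarith
      · have := le_abs_self (f n); have := abs_nonneg (f (-n)); simp only [hg]; linarith
    have key := layer_cake lam (aemeas_mono gm) ik igk
      (by rw [integral_sub iv iw, heq, sub_self]) (by
        intro t
        obtain ⟨a, ha, -, -, hr⟩ := upper_level gm t
        rw [hr, Ioo_int ha.2]
        have h1 : (1:ℝ) ∈ Icc (0:ℝ) 1 := by simp
        rw [intervalIntegral.integral_sub (lam_ivl' iv ha h1) (lam_ivl' iw ha h1)]
        linarith [hle a ha])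
    have : ∫ p, (aext φ f n (w p) + g p * (v p - w p)) ∂lam ≤ ∫ p, aext φ f n (v p) ∂lam := by
      refine integral_mono ((iaext n hn w iw).add igk) (iaext n hn v iv) fun p => ?_
      have := aext_tangent hf h hn (clp_mem hn (w p)) (v p)
      simp only [hg]
      have e : aext φ f n (w p) = φ (clp n (w p)) + f (clp n (w p)) * (w p - clp n (w p)) := rfl
      rw [e]; linarith
    rw [integral_add (iaext n hn w iw) igk] at this
    linarith
  have stepL : ∀ n : ℕ, ∫⁻ p, ENNReal.ofReal (aext φ f n (w p) - (φ 0 + f 0 * w p)) ∂lam ≤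
      ∫⁻ p, ENNReal.ofReal (φ (v p) - (φ 0 + f 0 * v p)) ∂lam := by
    intro n
    have hn : (0:ℝ) ≤ n := Nat.cast_nonneg n
    have hnn : ∀ x, 0 ≤ aext φ f n x - (φ 0 + f 0 * x) := fun x => by
      have := aext_tangent hf h hn (h0n n hn) x
      simp only [sub_zero] at this; linarith
    have jw : Integrable (fun p => aext φ f n (w p) - (φ 0 + f 0 * w p)) lam :=
      (iaext n hn w iw).sub (il w iw)
    have jv : Integrable (fun p => aext φ f n (v p) - (φ 0 + f 0 * v p)) lam :=
      (iaext n hn v iv).sub (il v iv)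
    calc _ = ENNReal.ofReal (∫ p, (aext φ f n (w p) - (φ 0 + f 0 * w p)) ∂lam) := by
          rw [ofReal_integral_eq_lintegral_ofReal jw (Filter.Eventually.of_forall fun p => hnn _)]
      _ ≤ ENNReal.ofReal (∫ p, (aext φ f n (v p) - (φ 0 + f 0 * v p)) ∂lam) := by
          apply ENNReal.ofReal_le_ofReal
          rw [integral_sub (iaext n hn w iw) (il w iw), integral_sub (iaext n hn v iv) (il v iv),
            integral_add (integrable_const _) (iw.const_mul _),
            integral_add (integrable_const _) (iv.const_mul _), integral_const_mul,
            integral_const_mul, heq]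
          linarith [step n hn]
      _ = ∫⁻ p, ENNReal.ofReal (aext φ f n (v p) - (φ 0 + f 0 * v p)) ∂lam := by
          rw [ofReal_integral_eq_lintegral_ofReal jv (Filter.Eventually.of_forall fun p => hnn _)]
      _ ≤ _ := by
          apply lintegral_mono
          intro p
          apply ENNReal.ofReal_le_ofReal
          have := h (clp n (v p)) (v p)
          unfold aext; linarith
  have hlim : ∀ p, Filter.liminf
      (fun n : ℕ => ENNReal.ofReal (aext φ f n (w p) - (φ 0 + f 0 * w p))) Filter.atTop =
      ENNReal.ofReal (φ (w p) - (φ 0 + f 0 * w p)) := by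
    intro p
    apply Filter.Tendsto.liminf_eq
    obtain ⟨N, hN⟩ := exists_nat_ge |w p|
    apply tendsto_const_nhds.congr'
    filter_upwards [Filter.eventually_ge_atTop N] with n hn
    have : w p ∈ Icc (-(n:ℝ)) n := abs_le.1 (hN.trans (by exact_mod_cast hn))
    unfold aext; rw [clp_of_mem this]; simp
  calc _ = ∫⁻ p, (Filter.liminf
      (fun n : ℕ => ENNReal.ofReal (aext φ f n (w p) - (φ 0 + f 0 * w p))) Filter.atTop) ∂lam := by
        simp only [hlim]
    _ ≤ Filter.liminf (fun n : ℕ => (∫⁻ p, ENNReal.ofReal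
          (aext φ f n (w p) - (φ 0 + f 0 * w p)) ∂lam)) Filter.atTop := by
        apply lintegral_liminf_le'
        intro n
        exact (((maext n).comp_aemeasurable mw).sub
          ((mw.const_mul _).const_add _)).ennreal_ofReal
    _ ≤ _ := by
        refine Filter.liminf_le_of_frequently_le' ?_
        exact Filter.Frequently.of_forall stepL

lemma cx_of_monotone {w v : ℝ → ℝ} (hw : MonotoneOn w (Ioo 0 1)) (hv : MonotoneOn v (Ioo 0 1))
    (iw : Integrable w lam) (iv : Integrable v lam)
    (hle : ∀ a ∈ Icc (0:ℝ) 1, ∫ p in a..1, w p ≤ ∫ p in a..1, v p)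
    (heq : ∫ p, w p ∂lam = ∫ p, v p ∂lam) :
    ConvexOrder (lam.map w) (lam.map v) := by
  have mw := aemeas_mono hw
  have mv := aemeas_mono hv
  have il : ∀ (α β : ℝ) (u : ℝ → ℝ), Integrable u lam → Integrable (fun p => α + β * u p) lam :=
    fun α β u hu => (integrable_const _).add (hu.const_mul _)
  have eql : ∀ α β : ℝ, ∫ p, (α + β * w p) ∂lam = ∫ p, (α + β * v p) ∂lam := by
    intro α β
    rw [integral_add (integrable_const _) (iw.const_mul _),
      integral_add (integrable_const _) (iv.const_mul _), integral_const_mul,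
      integral_const_mul, heq]
  have cont : ∀ φ : ℝ → ℝ, ConvexOn ℝ univ φ → Continuous φ := by
    intro φ hφ
    have := hφ.continuousOn_interior
    rw [interior_univ] at this
    exact continuousOn_univ.1 this
  -- real version
  have main : ∀ φ : ℝ → ℝ, ConvexOn ℝ univ φ → Integrable (fun p => φ (v p)) lam →
      Integrable (fun p => φ (w p)) lam ∧ ∫ p, φ (w p) ∂lam ≤ ∫ p, φ (v p) ∂lam := by
    intro φ hφ iφ
    have hc := cont φ hφ
    obtain ⟨f, hf, h⟩ := subgrad hφ
    have core := cx_core hw hv iw iv hle heq hc hf h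
    have hnn : ∀ x, 0 ≤ φ x - (φ 0 + f 0 * x) := fun x => by
      have := h 0 x
      simp only [sub_zero] at this; linarith
    have jv := iφ.sub (il (φ 0) (f 0) v iv)
    have ev := ofReal_integral_eq_lintegral_ofReal jv (Filter.Eventually.of_forall fun p => hnn _)
    simp only [Pi.sub_apply] at ev
    rw [← ev] at core
    have jw : Integrable (fun p => φ (w p) - (φ 0 + f 0 * w p)) lam := by
      refine ⟨((hc.measurable.comp_aemeasurable mw).sub
          ((mw.const_mul _).const_add _)).aestronglyMeasurable, ?_⟩
      rw [hasFiniteIntegral_iff_ofReal (Filter.Eventually.of_forall fun p => hnn _)]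
      exact core.trans_lt ENNReal.ofReal_lt_top
    have iwφ : Integrable (fun p => φ (w p)) lam := by
      have := jw.add (il (φ 0) (f 0) w iw)
      refine this.congr (Filter.Eventually.of_forall fun p => ?_)
      simp
    refine ⟨iwφ, ?_⟩
    have ew := ofReal_integral_eq_lintegral_ofReal jw (Filter.Eventually.of_forall fun p => hnn _)
    rw [← ew, ENNReal.ofReal_le_ofReal_iff (integral_nonneg fun p => hnn _),
      integral_sub iwφ (il _ _ w iw), integral_sub iφ (il _ _ v iv), eql] at core
    linarith
  constructor
  · intro φ hφ hnn
    have hc := cont φ hφ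
    rw [lintegral_map' (by fun_prop) mw, lintegral_map' (by fun_prop) mv]
    by_cases htop : ∫⁻ p, ENNReal.ofReal (φ (v p)) ∂lam = ⊤
    · rw [htop]; exact le_top
    have iφ : Integrable (fun p => φ (v p)) lam := by
      refine ⟨(hc.measurable.comp_aemeasurable mv).aestronglyMeasurable, ?_⟩
      rw [hasFiniteIntegral_iff_ofReal (Filter.Eventually.of_forall fun p => hnn _)]
      exact lt_top_iff_ne_top.2 htop
    obtain ⟨h1, h2⟩ := main φ hφ iφ
    rw [← ofReal_integral_eq_lintegral_ofReal h1 (Filter.Eventually.of_forall fun p => hnn _),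
      ← ofReal_integral_eq_lintegral_ofReal iφ (Filter.Eventually.of_forall fun p => hnn _)]
    exact ENNReal.ofReal_le_ofReal h2
  · intro φ hφ hint
    have hc := cont φ hφ
    have h2 := (integrable_map_measure (by fun_prop) mv).1 hint.right_of_add_measure
    rw [integral_map mw (by fun_prop), integral_map mv (by fun_prop)]
    exact (main φ hφ h2).2

lemma strictConvexOn_abs_rpow {ρ : ℝ} (hρ : 1 < ρ) :
    StrictConvexOn ℝ univ (fun x : ℝ => |x| ^ ρ) := by
  refine ⟨convex_univ, fun x _ y _ hxy a b ha hb hab => ?_⟩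
  simp only [smul_eq_mul]
  have hρ0 : 0 < ρ := by linarith
  by_cases h : |x| = |y|
  · have hyx : y = -x := by
      rcases abs_eq_abs.1 h with h | h
      · exact absurd h hxy
      · rw [h]; simp
    have hx0 : x ≠ 0 := by rintro rfl; simp at hyx; exact hxy hyx.symm
    have e : a * |x| ^ ρ + b * |y| ^ ρ = |x| ^ ρ := by
      rw [← h, ← add_mul, hab, one_mul]
    rw [e]
    apply Real.rpow_lt_rpow (abs_nonneg _) _ hρ0
    have : a * x + b * y = (a - b) * x := by rw [hyx]; ring
    rw [this, abs_mul]
    have h1 : |a - b| < 1 := by rw [abs_lt]; constructor <;> linarith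
    have h2 : 0 < |x| := abs_pos.2 hx0
    nlinarith
  · have := (strictConvexOn_rpow hρ).2 (x := |x|) (abs_nonneg x) (y := |y|) (abs_nonneg y) h ha hb hab
    simp only [smul_eq_mul] at this
    refine lt_of_le_of_lt ?_ this
    apply Real.rpow_le_rpow (abs_nonneg _) _ hρ0.le
    calc |a * x + b * y| ≤ |a * x| + |b * y| := abs_add_le _ _
      _ = a * |x| + b * |y| := by rw [abs_mul, abs_mul, abs_of_pos ha, abs_of_pos hb]

/-- derivative of the power function -/
def hh (ρ z : ℝ) : ℝ := ρ * |z| ^ (ρ - 2) * z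

/-- Bregman remainder -/
def RR (ρ z b : ℝ) : ℝ := |b| ^ ρ - |z| ^ ρ - hh ρ z * (b - z)

lemma RR_pos {ρ : ℝ} (hρ : 1 < ρ) {z b : ℝ} (h : b ≠ z) : 0 < RR ρ z b := by
  have hs := strictConvexOn_abs_rpow hρ
  have hd := hasDerivAt_abs_rpow z hρ
  unfold RR hh
  rcases lt_or_gt_of_ne h with h | h
  · have := hs.slope_lt_of_hasDerivAt (mem_univ b) (mem_univ z) h hd
    rw [slope_def_field, div_lt_iff₀ (sub_pos.2 h)] at this
    linarith
  · have := hs.lt_slope_of_hasDerivAt (mem_univ z) (mem_univ b) h hd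
    rw [slope_def_field, lt_div_iff₀ (sub_pos.2 h)] at this
    linarith

lemma RR_nonneg {ρ : ℝ} (hρ : 1 < ρ) (z b : ℝ) : 0 ≤ RR ρ z b := by
  by_cases h : b = z
  · subst h; simp [RR]
  · exact (RR_pos hρ h).le

lemma hh_mono {ρ : ℝ} (hρ : 1 < ρ) : Monotone (hh ρ) := by
  intro x y hxy
  rcases eq_or_lt_of_le hxy with rfl | hlt
  · exact le_rfl
  have h1 := RR_nonneg hρ x y
  have h2 := RR_nonneg hρ y x
  unfold RR at h1 h2
  by_contra hc
  push Not at hc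
  nlinarith [mul_pos (sub_pos.2 hc) (sub_pos.2 hlt)]

lemma hh_cont {ρ : ℝ} (hρ : 1 < ρ) : Continuous (hh ρ) := by
  have h := (contDiff_norm_rpow (E := ℝ) hρ).continuous_deriv le_rfl
  have e : deriv (fun x : ℝ => ‖x‖ ^ ρ) = hh ρ := by
    funext x
    exact (hasDerivAt_norm_rpow x hρ).deriv
  rwa [e] at h

lemma hh_bound {ρ : ℝ} (hρ : 1 < ρ) (z k : ℝ) : |hh ρ z * k| ≤ ρ * (|z| ^ ρ + |k| ^ ρ) := by
  have hρ0 : 0 < ρ := by linarith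
  have h1 : |hh ρ z| = ρ * |z| ^ (ρ - 1) := by
    by_cases hz : z = 0
    · subst hz; simp [hh]; right; rw [Real.zero_rpow (by linarith)]
    have hz' : 0 < |z| := abs_pos.2 hz
    unfold hh
    rw [abs_mul, abs_mul, abs_of_pos hρ0, abs_of_nonneg (Real.rpow_nonneg hz'.le _), mul_assoc]
    congr 1
    have : ρ - 1 = (ρ - 2) + 1 := by ring
    rw [this, Real.rpow_add hz', Real.rpow_one]
  rw [abs_mul, h1, mul_assoc]
  apply mul_le_mul_of_nonneg_left _ hρ0.le
  set M := max |z| |k| with hM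
  have hM0 : 0 ≤ M := (abs_nonneg z).trans (le_max_left _ _)
  have h2 : |z| ^ (ρ - 1) * |k| ≤ M ^ (ρ - 1) * M := by
    apply mul_le_mul _ (le_max_right _ _) (abs_nonneg _) (Real.rpow_nonneg hM0 _)
    exact Real.rpow_le_rpow (abs_nonneg _) (le_max_left _ _) (by linarith)
  have h3 : M ^ (ρ - 1) * M = M ^ ρ := by
    by_cases hM1 : M = 0
    · rw [hM1, Real.zero_rpow hρ0.ne']; simp
    · have hp : 0 < M := lt_of_le_of_ne hM0 (Ne.symm hM1)
      conv_lhs => rw [← Real.rpow_one M, ← Real.rpow_mul hM0, ← Real.rpow_add hp]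
      congr 1; ring
  rw [h3] at h2
  refine h2.trans ?_
  rcases max_choice |z| |k| with h | h
  · rw [hM, h]; have := Real.rpow_nonneg (abs_nonneg k) ρ; linarith
  · rw [hM, h]; have := Real.rpow_nonneg (abs_nonneg z) ρ; linarith

lemma RR_lower {ρ : ℝ} (hρ : 1 < ρ) {M δ : ℝ} (hδ : 0 < δ) (hM : 0 ≤ M) :
    ∃ c > 0, ∀ z b : ℝ, |z| ≤ M → δ ≤ |b - z| → c ≤ RR ρ z b := by
  have hρ0 : 0 < ρ := by linarith
  set F : ℝ → ℝ := fun z => min (RR ρ z (z + δ)) (RR ρ z (z - δ)) with hF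
  have hFc : Continuous F := by
    have h1 := hh_cont hρ
    have h2 : Continuous fun x : ℝ => |x| ^ ρ := continuous_abs.rpow_const fun _ => Or.inr hρ0.le
    have h3 : Continuous fun x : ℝ => |x + δ| ^ ρ := h2.comp (continuous_add_const δ)
    have h4 : Continuous fun x : ℝ => |x - δ| ^ ρ := h2.comp (by fun_prop : Continuous fun x : ℝ => x - δ)
    simp only [hF, RR]
    fun_prop
  obtain ⟨m, hmI, hm⟩ := (isCompact_Icc (a := -M) (b := M)).exists_isMinOn
    (nonempty_Icc.2 (by linarith)) hFc.continuousOn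
  refine ⟨F m, lt_min (RR_pos hρ (by linarith)) (RR_pos hρ (by linarith)), ?_⟩
  intro z b hz hb
  refine le_trans (hm (abs_le.1 hz)) ?_
  -- convexity
  have hpos : 0 < |b - z| := hδ.trans_le hb
  set θ := δ / |b - z| with hθ
  have hθ0 : 0 < θ := by positivity
  have hθ1 : θ ≤ 1 := (div_le_one hpos).2 hb
  have hconv := (strictConvexOn_abs_rpow hρ).convexOn.2 (mem_univ z) (mem_univ b)
    (sub_nonneg.2 hθ1) hθ0.le (by ring)
  simp only [smul_eq_mul] at hconv
  set y := (1 - θ) * z + θ * b with hy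
  have hyz : y - z = θ * (b - z) := by rw [hy]; ring
  have h1 : RR ρ z y ≤ θ * RR ρ z b := by
    unfold RR; rw [hyz]; linarith
  have h2 : θ * RR ρ z b ≤ RR ρ z b := by
    have := RR_nonneg hρ z b; nlinarith
  refine le_trans ?_ (h1.trans h2)
  have hθm : θ * |b - z| = δ := by rw [hθ]; field_simp
  rcases le_total 0 (b - z) with hs | hs
  · rw [abs_of_nonneg hs] at hθm
    have : y = z + δ := by linarith
    rw [this]; exact min_le_left _ _
  · rw [abs_of_nonpos hs] at hθm
    have : y = z - δ := by linarith
    rw [this]; exact min_le_right _ _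

lemma rd_affine {f : ℝ → ℝ} {α β x : ℝ} (h : ∀ᶠ y in nhds x, f y = α + β * y) : rd f x = β := by
  have h1 : HasDerivAt (fun y => α + β * y) β x := by
    simpa using ((hasDerivAt_id x).const_mul β).const_add α
  have h2 : HasDerivAt f β x := h1.congr_of_eventuallyEq h
  exact h2.hasDerivWithinAt.derivWithin (uniqueDiffWithinAt_Ioi x)

lemma struct {u v ψ : ℝ → ℝ} (hu : MonotoneOn u (Ioo 0 1)) (hv : MonotoneOn v (Ioo 0 1))
    (iu : Integrable u lam) (iv : Integrable v lam)
    (hψconv : ConvexOn ℝ (Icc 0 1) ψ)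
    (hψle : ∀ q ∈ Icc (0:ℝ) 1, ψ q ≤ ∫ p in (0:ℝ)..q, (u p - v p))
    (hψmax : ∀ χ : ℝ → ℝ, ConvexOn ℝ (Icc 0 1) χ →
        (∀ q ∈ Icc (0:ℝ) 1, χ q ≤ ∫ p in (0:ℝ)..q, (u p - v p)) →
        ∀ q ∈ Icc (0:ℝ) 1, χ q ≤ ψ q) :
    ∃ s w S : ℝ → ℝ, MonotoneOn s (Ioo 0 1) ∧ MonotoneOn w (Ioo 0 1) ∧
      Integrable w lam ∧
      (∀ q ∈ Icc (0:ℝ) 1, ∫ p in (0:ℝ)..q, w p = (∫ p in (0:ℝ)..q, u p) - ψ q) ∧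
      (∀ q ∈ Icc (0:ℝ) 1, ∫ p in q..1, w p ≤ ∫ p in q..1, v p) ∧
      (∫ p in (0:ℝ)..1, w p = ∫ p in (0:ℝ)..1, v p) ∧
      LipschitzWith 1 S ∧ (∀ᵐ p ∂lam, S (u p) = s p ∧ w p = u p - s p) ∧
      (∀ a ∈ Icc (0:ℝ) 1, (∀ p ∈ Ioo 0 a, ∀ q ∈ Ioo a 1, s p < s q) →
        ∫ p in a..1, w p = ∫ p in a..1, v p) := by
  have I0 : (0:ℝ) ∈ Icc (0:ℝ) 1 := by simp
  have I1 : (1:ℝ) ∈ Icc (0:ℝ) 1 := by simp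
  set U : ℝ → ℝ := fun q => ∫ p in (0:ℝ)..q, u p with hU
  set V : ℝ → ℝ := fun q => ∫ p in (0:ℝ)..q, v p with hV
  set G : ℝ → ℝ := fun q => ∫ p in (0:ℝ)..q, (u p - v p) with hG
  have hGe : ∀ q ∈ Icc (0:ℝ) 1, G q = U q - V q := fun q hq =>
    intervalIntegral.integral_sub (lam_ivl' iu I0 hq) (lam_ivl' iv I0 hq)
  have cU : ContinuousOn U (Icc 0 1) := cont_int iu
  have cG : ContinuousOn G (Icc 0 1) := cont_int (iu.sub iv)
  obtain ⟨e0, e1, cψ⟩ := hull_props cG hψconv hψle hψmax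
  have hG0 : G 0 = 0 := by simp [hG]
  set Θ : ℝ → ℝ := fun q => U q - ψ q with hΘ
  have cΘ : ContinuousOn Θ (Icc 0 1) := cU.sub cψ
  have hΘV : ∀ q ∈ Icc (0:ℝ) 1, V q ≤ Θ q := fun q hq => by
    have := hψle q hq
    have h2 := hGe q hq
    simp only [hΘ]
    have h3 : ψ q ≤ G q := this
    linarith
  have convΘ : ConvexOn ℝ (Icc 0 1) Θ := by
    apply convexOn_of_local_support cΘ
    intro c hc
    have hcI := Ioo_subset_Icc_self hc
    rcases eq_or_lt_of_le (hψle c hcI) with h | h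
    · refine ⟨v c, ?_⟩
      filter_upwards [Icc_mem_nhds hc.1 hc.2] with x hx
      have h1 := support_int hv iv hc hx
      have h2 := hΘV x hx
      have h3 : ψ c = G c := h
      have h4 : Θ c = V c := by simp only [hΘ]; rw [h3, hGe c hcI]; ring
      rw [h4]
      exact h1.trans h2
    · obtain ⟨α, β, hαβ⟩ := hull_affine cG hψconv hψle hψmax hc h
      refine ⟨u c - β, ?_⟩
      filter_upwards [Icc_mem_nhds hc.1 hc.2, hαβ] with x hx hx2
      have h1 : U c + u c * (x - c) ≤ U x := support_int hu iu hc hx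
      have h2 := hαβ.self_of_nhds
      simp only [hΘ]
      rw [hx2, h2]; linarith
  have hΘ0 : Θ 0 = 0 := by simp only [hΘ]; rw [e0, hG0]; simp [hU]
  have hΘ1 : Θ 1 = V 1 := by simp only [hΘ]; rw [e1, hGe 1 I1]; ring
  have ms := rd_mono hψconv
  have mw := rd_mono convΘ
  have iw := rd_integrable convΘ cΘ
  have hV1 : ∀ q ∈ Icc (0:ℝ) 1, ∫ p in q..1, v p = V 1 - V q := fun q hq => by
    have := intervalIntegral.integral_add_adjacent_intervals (lam_ivl' iv I0 hq) (lam_ivl' iv hq I1)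
    simp only [hV]; linarith
  have hW1 : ∀ q ∈ Icc (0:ℝ) 1, ∫ p in q..1, rd Θ p = Θ 1 - Θ q := fun q hq =>
    rd_integral convΘ cΘ hq.1 hq.2 le_rfl
  have hsum : ∀ᵐ p ∂lam, rd ψ p + rd Θ p = u p := by
    have hae := (lam_ivl iu).ae_hasDerivAt_integral
    filter_upwards [ae_restrict_of_ae hae, ae_restrict_mem measurableSet_Ioo] with p hp hpI
    rw [uIcc_of_le zero_le_one] at hp
    have h1 := (hp (Ioo_subset_Icc_self hpI) 0 I0).hasDerivWithinAt (s := Ioi p)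
    have h2 := (rd_has hψconv hpI).add (rd_has convΘ hpI)
    have h3 : (ψ + Θ) = U := by funext q; simp [hΘ]
    rw [h3] at h2
    rw [← h1.derivWithin (uniqueDiffWithinAt_Ioi p), ← h2.derivWithin (uniqueDiffWithinAt_Ioi p)]
  -- the Lipschitz map
  obtain ⟨S, hSL, hSe⟩ : ∃ S : ℝ → ℝ, LipschitzWith 1 S ∧
      ∀ p ∈ Ioo (0:ℝ) 1, rd ψ p + rd Θ p = u p → S (u p) = rd ψ p := by
    set D : Set ℝ := {p | p ∈ Ioo (0:ℝ) 1 ∧ rd ψ p + rd Θ p = u p} with hD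
    set f : ℝ → ℝ := fun x => rd ψ (Function.invFunOn u D x) with hf
    have key : ∀ p ∈ D, ∀ q ∈ D, |rd ψ p - rd ψ q| ≤ |u p - u q| := by
      have aux : ∀ p ∈ D, ∀ q ∈ D, p ≤ q → |rd ψ p - rd ψ q| ≤ |u p - u q| := by
        intro p hp q hq hpq
        have a1 := ms hp.1 hq.1 hpq
        have a2 := mw hp.1 hq.1 hpq
        have a3 := hp.2
        have a4 := hq.2
        rw [abs_of_nonpos (by linarith), abs_of_nonpos (by linarith)]
        linarith
      intro p hp q hq
      rcases le_total p q with h | h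
      · exact aux p hp q hq h
      · rw [abs_sub_comm, abs_sub_comm (u p)]; exact aux q hq p hp h
    have hL : LipschitzOnWith 1 f (u '' D) := by
      apply LipschitzOnWith.of_dist_le_mul
      intro x hx y hy
      have hx1 := Function.invFunOn_mem hx
      have hx2 := Function.invFunOn_eq hx
      have hy1 := Function.invFunOn_mem hy
      have hy2 := Function.invFunOn_eq hy
      have := key _ hx1 _ hy1
      rw [hx2, hy2] at this
      simp only [Real.dist_eq, NNReal.coe_one, one_mul]
      exact this
    obtain ⟨S, h1, h2⟩ := hL.extend_real
    refine ⟨S, h1, fun p hp hpe => ?_⟩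
    have hpD : p ∈ D := ⟨hp, hpe⟩
    have himg : u p ∈ u '' D := ⟨p, hpD, rfl⟩
    rw [← h2 himg]
    have hx1 := Function.invFunOn_mem himg
    have hx2 := Function.invFunOn_eq himg
    have := key _ hx1 _ hpD
    rw [hx2, sub_self, abs_zero] at this
    have := abs_nonpos_iff.1 this
    simp only [hf]
    linarith
  refine ⟨rd ψ, rd Θ, S, ms, mw, iw, ?_, ?_, ?_, hSL, ?_, ?_⟩
  · intro q hq
    rw [rd_integral convΘ cΘ le_rfl hq.1 hq.2, hΘ0, sub_zero]
  · intro q hq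
    rw [hV1 q hq, hW1 q hq, hΘ1]
    linarith [hΘV q hq]
  · rw [hW1 0 I0, hΘ0, hΘ1]; simp [hV]
  · filter_upwards [hsum, ae_restrict_mem measurableSet_Ioo] with p hp hpI
    exact ⟨hSe p hpI hp, by linarith⟩
  · intro a ha hlt
    rw [hV1 a ha, hW1 a ha, hΘ1]
    have : ψ a = G a := by
      rcases eq_or_lt_of_le ha.1 with h | h0
      · rw [← h]; exact e0
      rcases eq_or_lt_of_le ha.2 with h | h1
      · rw [h]; exact e1
      by_contra hne
      have hψG : ψ a < G a := lt_of_le_of_ne (hψle a ha) hne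
      obtain ⟨α, β, hαβ⟩ := hull_affine cG hψconv hψle hψmax ⟨h0, h1⟩ hψG
      have hev := hαβ.eventually_nhds.and (Ioo_mem_nhds h0 h1)
      obtain ⟨ε, hε, hball⟩ := Metric.eventually_nhds_iff.1 hev
      have b1 := hball (y := a + ε / 2) (by simp [abs_of_pos hε]; linarith)
      have b2 := hball (y := a - ε / 2) (by simp [abs_of_pos hε]; linarith)
      have := hlt (a - ε/2) ⟨b2.2.1, by linarith⟩ (a + ε/2) ⟨by linarith, b1.2.2⟩
      rw [rd_affine b1.1, rd_affine b2.1] at this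
      exact lt_irrefl _ this
    have h2 : Θ a = V a := by simp only [hΘ]; rw [this, hGe a ha]; ring
    rw [h2]

lemma rearr {Ω : Type*} [MeasurableSpace Ω] (P : Measure Ω) [IsProbabilityMeasure P]
    {Y : Ω → ℝ} {v : ℝ → ℝ} (hv : MonotoneOn v (Ioo 0 1)) (iv : Integrable v lam)
    (iY : Integrable Y P) (hE : ∫ ω, Y ω ∂P = ∫ p, v p ∂lam)
    (hc : ∀ c : ℝ, ∫ ω, max (Y ω - c) 0 ∂P ≤ ∫ p, max (v p - c) 0 ∂lam)
    {A : Set Ω} (hA : MeasurableSet A) {a : ℝ} (ha : a ∈ Icc (0:ℝ) 1)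
    (hPA : P A = ENNReal.ofReal (1 - a)) : ∫ ω in A, Y ω ∂P ≤ ∫ p in a..1, v p := by
  rcases eq_or_lt_of_le ha.1 with h0 | h0
  · subst h0
    have h1 : P A = 1 := by simpa using hPA
    have h2 : ∀ᵐ ω ∂P, ω ∈ A := by
      rw [← prob_compl_eq_zero_iff hA] at h1
      exact h1
    rw [Measure.restrict_eq_self_of_ae_mem h2, hE, lam_int]
  rcases eq_or_lt_of_le ha.2 with h1 | h1
  · subst h1
    have : P A = 0 := by simpa using hPA
    rw [setIntegral_measure_zero _ this]; simp
  set c := v a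
  have ic : Integrable (fun ω => Y ω - c) P := iY.sub (integrable_const c)
  have im : Integrable (fun ω => max (Y ω - c) 0) P := ic.sup (integrable_zero _ _ _)
  have jc : Integrable (fun p => v p - c) lam := iv.sub (integrable_const c)
  have jm : Integrable (fun p => max (v p - c) 0) lam := jc.sup (integrable_zero _ _ _)
  have e1 : ∫ ω in A, Y ω ∂P = ∫ ω in A, (Y ω - c) ∂P + (1 - a) * c := by
    rw [integral_sub iY.integrableOn (integrable_const c).integrableOn]
    simp [Measure.real, hPA, ENNReal.toReal_ofReal (by linarith [ha.2] : 0 ≤ 1 - a)]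
  have e2 : ∫ ω in A, (Y ω - c) ∂P ≤ ∫ ω, max (Y ω - c) 0 ∂P := by
    calc _ ≤ ∫ ω in A, max (Y ω - c) 0 ∂P :=
          integral_mono ic.integrableOn im.integrableOn fun ω => le_max_left _ _
      _ ≤ _ := setIntegral_le_integral im (Filter.Eventually.of_forall fun ω => le_max_right _ _)
  have e3 : ∫ p, max (v p - c) 0 ∂lam = ∫ p in a..1, (v p - c) := by
    rw [lam_int, ← intervalIntegral.integral_add_adjacent_intervals
      (lam_ivl' jm ⟨le_rfl, zero_le_one⟩ ha) (lam_ivl' jm ha ⟨zero_le_one, le_rfl⟩)]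
    have z1 : ∫ p in (0:ℝ)..a, max (v p - c) 0 = 0 := by
      rw [intervalIntegral.integral_of_le ha.1]
      apply setIntegral_eq_zero_of_forall_eq_zero
      intro p hp
      have := hv ⟨hp.1, hp.2.trans_lt h1⟩ ⟨h0, h1⟩ hp.2
      simp [c, this]
    have z2 : ∫ p in a..1, max (v p - c) 0 = ∫ p in a..1, (v p - c) := by
      rw [← Ioo_int ha.2, ← Ioo_int ha.2]
      apply setIntegral_congr_fun measurableSet_Ioo
      intro p hp
      have := hv ⟨h0, h1⟩ ⟨h0.trans hp.1, hp.2⟩ hp.1.le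
      simp [c, this]
    rw [z1, z2, zero_add]
  have e4 : ∫ p in a..1, (v p - c) = (∫ p in a..1, v p) - (1 - a) * c := by
    rw [intervalIntegral.integral_sub (lam_ivl' iv ha ⟨zero_le_one, le_rfl⟩) (by simp)]
    simp
  linarith [hc c]

lemma lint_int {η ν : Measure ℝ} {φ : ℝ → ℝ} (hφ : Continuous φ) (h0 : ∀ x, 0 ≤ φ x)
    (hle : ∫⁻ x, ENNReal.ofReal (φ x) ∂η ≤ ∫⁻ x, ENNReal.ofReal (φ x) ∂ν)
    (hi : Integrable φ ν) : Integrable φ η ∧ ∫ x, φ x ∂η ≤ ∫ x, φ x ∂ν := by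
  have hf : ∫⁻ x, ENNReal.ofReal (φ x) ∂ν < ⊤ := by
    have := hi.2
    rwa [hasFiniteIntegral_iff_ofReal (Filter.Eventually.of_forall h0)] at this
  refine ⟨⟨hφ.aestronglyMeasurable, ?_⟩, ?_⟩
  · rw [hasFiniteIntegral_iff_ofReal (Filter.Eventually.of_forall h0)]
    exact hle.trans_lt hf
  · rw [integral_eq_lintegral_of_nonneg_ae (Filter.Eventually.of_forall h0) hφ.aestronglyMeasurable,
      integral_eq_lintegral_of_nonneg_ae (Filter.Eventually.of_forall h0) hφ.aestronglyMeasurable]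
    exact ENNReal.toReal_mono hf.ne hle

lemma int_of_abs {μ : Measure ℝ} (h : Integrable (fun x => |x|) μ) : Integrable (fun x => x) μ :=
  (integrable_norm_iff (f := fun x : ℝ => x) continuous_id.aestronglyMeasurable).1 h

lemma convexOn_abs_id : ConvexOn ℝ univ (fun x : ℝ => |x|) := 
  convexOn_norm (E := ℝ) convex_univ

lemma convexOn_call (c : ℝ) : ConvexOn ℝ univ (fun x : ℝ => max (x - c) 0) := by
  have h1 : ConvexOn ℝ univ (fun x : ℝ => x - c) := 
    (convexOn_id (𝕜 := ℝ) (β := ℝ) convex_univ).add_const (-c)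
  exact h1.sup (convexOn_const 0 convex_univ)

lemma cx_facts {η ν : Measure ℝ} [IsProbabilityMeasure η] [IsProbabilityMeasure ν]
    (h : ConvexOrder η ν) (hν1 : Integrable (fun x => |x|) ν) :
    Integrable (fun x => x) η ∧ ∫ x, x ∂η = ∫ p, quantileFn ν p ∂lam ∧
    (∀ c : ℝ, ∫ x, max (x - c) 0 ∂η ≤ ∫ p, max (quantileFn ν p - c) 0 ∂lam) ∧
    (∀ ρ : ℝ, 1 < ρ → Integrable (fun x => |x| ^ ρ) ν → Integrable (fun x => |x| ^ ρ) η) := by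
  have i1 := int_of_abs hν1
  have j1 : Integrable (fun x => x) η := int_of_abs
    (lint_int continuous_abs abs_nonneg (h.1 _ convexOn_abs_id abs_nonneg) hν1).1
  have qm : AEMeasurable (quantileFn ν) lam := aemeas_mono (quantile_mono ν)
  refine ⟨j1, ?_, ?_, ?_⟩
  · have a1 := h.2 (fun x => x) (convexOn_id convex_univ) (integrable_add_measure.2 ⟨j1, i1⟩)
    have a2 := h.2 (fun x => -x) (concaveOn_id convex_univ).neg
      (integrable_add_measure.2 ⟨j1.neg, i1.neg⟩)
    rw [integral_neg, integral_neg] at a2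
    have e : ∫ x, x ∂ν = ∫ p, quantileFn ν p ∂lam := by
      conv_lhs => rw [← quantile_map ν]
      exact integral_map (f := fun x : ℝ => x) qm continuous_id.aestronglyMeasurable
    linarith
  · intro c
    have hcc : Continuous (fun x : ℝ => max (x - c) 0) := by fun_prop
    have := (lint_int hcc (fun x => le_max_right _ _)
      (h.1 _ (convexOn_call c) (fun x => le_max_right _ _))
      ((i1.sub (integrable_const c)).sup (integrable_zero _ _ _))).2
    have e : ∫ x, max (x - c) 0 ∂ν = ∫ p, max (quantileFn ν p - c) 0 ∂lam := by
      conv_lhs => rw [← quantile_map ν]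
      rw [integral_map qm hcc.aestronglyMeasurable]
    linarith
  · intro ρ hρ hi
    have h0 : ∀ x : ℝ, 0 ≤ |x| ^ ρ := fun x => by positivity
    exact (lint_int (continuous_abs.rpow_const fun x => Or.inr (by linarith)) h0
      (h.1 _ (strictConvexOn_abs_rpow hρ).convexOn h0) hi).1

lemma memLp_abs_iff {Ω : Type*} [MeasurableSpace Ω] {P : Measure Ω} {f : Ω → ℝ} {ρ : ℝ}
    (hρ : 1 < ρ) (hf : AEStronglyMeasurable f P) :
    Integrable (fun ω => |f ω| ^ ρ) P ↔ MemLp f (ENNReal.ofReal ρ) P := by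
  have h := integrable_norm_rpow_iff (p := ENNReal.ofReal ρ) hf
    (by simp; linarith) ENNReal.ofReal_ne_top
  rw [ENNReal.toReal_ofReal (by linarith)] at h
  exact h

lemma memLp_lip {μ : Measure ℝ} [IsProbabilityMeasure μ] {S : ℝ → ℝ} (hS : LipschitzWith 1 S)
    {p : ℝ≥0∞} (h : MemLp (fun x => x) p μ) : MemLp S p μ := by
  have h1 : MemLp (fun x => S x - S 0) p μ := by
    refine h.of_le (hS.continuous.sub continuous_const).aestronglyMeasurable
      (Filter.Eventually.of_forall fun x => ?_)
    have := hS.dist_le_mul x 0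
    simpa [Real.dist_eq] using this
  have h2 := h1.add (memLp_const (S 0))
  exact h2.congr_norm hS.continuous.aestronglyMeasurable
    (Filter.Eventually.of_forall fun x => by simp)

lemma level_facts {u v s w S : ℝ → ℝ} {μ : Measure ℝ} (hu : AEMeasurable u lam)
    (hμ : lam.map u = μ)
    (hs : MonotoneOn s (Ioo 0 1)) (hS : LipschitzWith 1 S)
    (hae : ∀ᵐ p ∂lam, S (u p) = s p ∧ w p = u p - s p)
    (hct : ∀ a ∈ Icc (0:ℝ) 1, (∀ p ∈ Ioo 0 a, ∀ q ∈ Ioo a 1, s p < s q) →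
      ∫ p in a..1, w p = ∫ p in a..1, v p)
    {f : ℝ → ℝ} (hf : Monotone f) (hfc : Continuous f) (t : ℝ) :
    ∃ a ∈ Icc (0:ℝ) 1, μ {x | t < f (S x)} = ENNReal.ofReal (1 - a) ∧
      ∫ x in {x | t < f (S x)}, (x - S x) ∂μ = ∫ p in a..1, v p := by
  have hg : MonotoneOn (fun p => f (s p)) (Ioo 0 1) := fun a ha b hb hab => hf (hs ha hb hab)
  obtain ⟨a, ha, h1, h2, hr⟩ := upper_level hg t
  have hB : MeasurableSet {x | t < f (S x)} :=
    (isOpen_lt continuous_const (hfc.comp hS.continuous)).measurableSet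
  have hset : (u ⁻¹' {x | t < f (S x)} : Set ℝ) =ᵐ[lam] {p | t < f (s p)} := by
    filter_upwards [hae] with p hp
    apply propext
    change t < f (S (u p)) ↔ t < f (s p)
    rw [hp.1]
  refine ⟨a, ha, ?_, ?_⟩
  · rw [← hμ, Measure.map_apply_of_aemeasurable hu hB, measure_congr hset]
    have := congrArg (fun m : Measure ℝ => m univ) hr
    simpa using this
  · rw [← hct a ha fun p hp q hq => ?_]
    · have hTc : Continuous (fun x => x - S x) := continuous_id.sub hS.continuous
      rw [← hμ, setIntegral_map hB hTc.aestronglyMeasurable hu,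
        Measure.restrict_congr_set hset, ← Ioo_int ha.2, ← hr]
      apply integral_congr_ae
      filter_upwards [ae_restrict_of_ae hae] with p hp
      simp [hp.1, hp.2]
    · by_contra hcon
      have e1 := hf (not_lt.1 hcon)
      have e2 := h1 q hq
      have e3 := h2 p ⟨hp.1, hp.2.trans_le ha.2⟩ hp.2
      linarith

lemma lower {μ ν η : Measure ℝ} [IsProbabilityMeasure μ] [IsProbabilityMeasure ν]
    [IsProbabilityMeasure η] (hν1 : Integrable (fun x => |x|) ν) (hμ1 : Integrable (fun x => |x|) μ)
    (hcx : ConvexOrder η ν) {ρ : ℝ} (hρ : 1 < ρ) (hμρ : Integrable (fun x => |x| ^ ρ) μ)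
    (hνρ : Integrable (fun x => |x| ^ ρ) ν) {s w S : ℝ → ℝ}
    (hs : MonotoneOn s (Ioo 0 1)) (hS : LipschitzWith 1 S)
    (hae : ∀ᵐ p ∂lam, S (quantileFn μ p) = s p ∧ w p = quantileFn μ p - s p)
    (htot : ∫ p in (0:ℝ)..1, w p = ∫ p in (0:ℝ)..1, quantileFn ν p)
    (hct : ∀ a ∈ Icc (0:ℝ) 1, (∀ p ∈ Ioo 0 a, ∀ q ∈ Ioo a 1, s p < s q) →
      ∫ p in a..1, w p = ∫ p in a..1, quantileFn ν p)
    (π : Measure (ℝ × ℝ)) (h1 : π.map Prod.fst = μ) (h2 : π.map Prod.snd = η) :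
    Integrable (fun z : ℝ × ℝ => |z.1 - z.2| ^ ρ) π ∧
    Integrable (fun z : ℝ × ℝ => RR ρ (S z.1) (z.1 - z.2)) π ∧
    ∫ z, RR ρ (S z.1) (z.1 - z.2) ∂π ≤ ∫ z, |z.1 - z.2| ^ ρ ∂π - ∫ x, |S x| ^ ρ ∂μ := by
  have hπ : IsProbabilityMeasure π := by
    constructor
    have : (π.map Prod.fst) univ = 1 := by rw [h1]; simp
    rwa [Measure.map_apply measurable_fst MeasurableSet.univ, preimage_univ] at this
  obtain ⟨iη, hE, hcall, hηρ⟩ := cx_facts hcx hν1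
  have iη' := hηρ ρ hρ hνρ
  have qm : AEMeasurable (quantileFn μ) lam := aemeas_mono (quantile_mono μ)
  have iμ := int_of_abs hμ1
  set p : ℝ≥0∞ := ENNReal.ofReal ρ with hp
  have mμ : MemLp (fun x => x) p μ := (memLp_abs_iff hρ continuous_id.aestronglyMeasurable).1 hμρ
  have mη : MemLp (fun x => x) p η := (memLp_abs_iff hρ continuous_id.aestronglyMeasurable).1 iη'
  have mS : MemLp S p μ := memLp_lip hS mμ
  have a1 : AEMeasurable (Prod.fst : ℝ × ℝ → ℝ) π := measurable_fst.aemeasurable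
  have a2 : AEMeasurable (Prod.snd : ℝ × ℝ → ℝ) π := measurable_snd.aemeasurable
  have MX : MemLp (fun z : ℝ × ℝ => z.1) p π := by
    rw [← h1] at mμ; exact mμ.comp_of_map a1
  have MY : MemLp (fun z : ℝ × ℝ => z.2) p π := by
    rw [← h2] at mη; exact mη.comp_of_map a2
  have MS : MemLp (fun z : ℝ × ℝ => S z.1) p π := by
    rw [← h1] at mS; exact mS.comp_of_map a1
  have hp1 : 1 ≤ p := by simpa [hp] using hρ.le
  have MXY : MemLp (fun z : ℝ × ℝ => z.1 - z.2) p π := MX.sub MY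
  have Mk : MemLp (fun z : ℝ × ℝ => z.1 - S z.1 - z.2) p π := (MX.sub MS).sub MY
  have IXY := (memLp_abs_iff hρ MXY.1).2 MXY
  have IS := (memLp_abs_iff hρ MS.1).2 MS
  have Ik := (memLp_abs_iff hρ Mk.1).2 Mk
  have jX : Integrable (fun z : ℝ × ℝ => z.1) π := MX.integrable hp1
  have jY : Integrable (fun z : ℝ × ℝ => z.2) π := MY.integrable hp1
  have jS : Integrable (fun z : ℝ × ℝ => S z.1) π := MS.integrable hp1
  have jT : Integrable (fun z : ℝ × ℝ => z.1 - S z.1) π := jX.sub jS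
  have jk : Integrable (fun z : ℝ × ℝ => z.1 - S z.1 - z.2) π := jT.sub jY
  have hgc : Continuous (fun z : ℝ × ℝ => hh ρ (S z.1)) :=
    (hh_cont hρ).comp (hS.continuous.comp continuous_fst)
  have igk : Integrable (fun z : ℝ × ℝ => hh ρ (S z.1) * (z.1 - S z.1 - z.2)) π := by
    refine Integrable.mono' ((IS.add Ik).const_mul ρ)
      (hgc.aestronglyMeasurable.mul jk.1) (Filter.Eventually.of_forall fun z => ?_)
    exact hh_bound hρ _ _
  -- pushing integrals
  have EY : ∫ z, z.2 ∂π = ∫ p, quantileFn ν p ∂lam := by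
    rw [← hE, ← h2]
    exact (integral_map (f := fun x : ℝ => x) a2 continuous_id.aestronglyMeasurable).symm
  have hTc : Continuous (fun x => x - S x) := continuous_id.sub hS.continuous
  have ET : ∫ z, (z.1 - S z.1) ∂π = ∫ p, quantileFn ν p ∂lam := by
    have e1 : ∫ z, (z.1 - S z.1) ∂π = ∫ x, (x - S x) ∂μ := by
      rw [← h1]
      exact (integral_map (f := fun x => x - S x) a1 hTc.aestronglyMeasurable).symm
    have e2 : ∫ x, (x - S x) ∂μ = ∫ p, w p ∂lam := by
      conv_lhs => rw [← quantile_map μ]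
      rw [integral_map qm hTc.aestronglyMeasurable]
      apply integral_congr_ae
      filter_upwards [hae] with p hp
      rw [hp.1, hp.2]
    rw [e1, e2, lam_int, lam_int, htot]
  have key : 0 ≤ ∫ z, hh ρ (S z.1) * (z.1 - S z.1 - z.2) ∂π := by
    refine layer_cake π hgc.measurable.aemeasurable jk igk ?_ fun t => ?_
    · rw [integral_sub jT jY, ET, EY, sub_self]
    · obtain ⟨a, ha, hPA, hint⟩ := level_facts (v := quantileFn ν) qm (quantile_map μ) hs hS hae hct
        (hh_mono hρ) (hh_cont hρ) t
      have hB : MeasurableSet {x | t < hh ρ (S x)} :=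
        (isOpen_lt continuous_const ((hh_cont hρ).comp hS.continuous)).measurableSet
      have hA : MeasurableSet {z : ℝ × ℝ | t < hh ρ (S z.1)} := measurable_fst hB
      rw [integral_sub jT.integrableOn jY.integrableOn]
      have f1 : ∫ z in {z : ℝ × ℝ | t < hh ρ (S z.1)}, (z.1 - S z.1) ∂π
          = ∫ p in a..1, quantileFn ν p := by
        rw [← hint, ← h1, setIntegral_map hB hTc.aestronglyMeasurable a1]
        rfl
      have f2 := rearr π (Y := fun z : ℝ × ℝ => z.2) (quantile_mono ν)
        (quantile_integrable ν (int_of_abs hν1)) jY EY (fun c => ?_) hA ha ?_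
      · linarith
      · refine le_trans (le_of_eq ?_) (hcall c)
        rw [← h2]
        exact (integral_map (f := fun x : ℝ => max (x - c) 0) a2
          (by fun_prop : Continuous (fun x : ℝ => max (x - c) 0)).aestronglyMeasurable).symm
      · rw [← hPA, ← h1, Measure.map_apply measurable_fst hB]
        rfl
  have hRR : (fun z : ℝ × ℝ => RR ρ (S z.1) (z.1 - z.2)) = fun z : ℝ × ℝ =>
      |z.1 - z.2| ^ ρ - |S z.1| ^ ρ - hh ρ (S z.1) * (z.1 - S z.1 - z.2) := by
    funext z; unfold RR; ring
  refine ⟨IXY, ?_, ?_⟩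
  · rw [hRR]; exact (IXY.sub IS).sub igk
  · have e3 : ∫ x, |S x| ^ ρ ∂μ = ∫ z, |S z.1| ^ ρ ∂π := by
      rw [← h1]
      exact integral_map (f := fun x => |S x| ^ ρ) a1
        ((hS.continuous.abs).rpow_const fun x => Or.inr (by linarith)).aestronglyMeasurable
    have IXS : Integrable (fun z : ℝ × ℝ => |z.1 - z.2| ^ ρ - |S z.1| ^ ρ) π := IXY.sub IS
    rw [hRR, integral_sub IXS igk, integral_sub IXY IS, e3]
    linarith

lemma cdf_le_of_close {F G : Measure ℝ} [IsProbabilityMeasure F] [IsProbabilityMeasure G]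
    (h : ∀ x δ ε : ℝ, 0 < δ → 0 < ε → F.real (Iic x) ≤ G.real (Iic (x + δ)) + ε) (x : ℝ) :
    F.real (Iic x) ≤ G.real (Iic x) := by
  have h1 : ∀ y, x < y → cdf F x ≤ cdf G y := by
    intro y hy
    rw [cdf_eq_real, cdf_eq_real]
    refine le_of_forall_pos_le_add fun ε hε => ?_
    have := h x (y - x) ε (by linarith) hε
    simpa using this
  rw [← cdf_eq_real, ← cdf_eq_real]
  have hr : Filter.Tendsto (cdf G) (nhdsWithin x (Ioi x)) (nhds (cdf G x)) :=
    ((cdf G).right_continuous x).mono_left (nhdsWithin_mono _ Ioi_subset_Ici_self)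
  exact ge_of_tendsto hr (by filter_upwards [self_mem_nhdsWithin] with y hy using h1 y hy)

lemma real_union_bound {Ω : Type*} [MeasurableSpace Ω] (P : Measure Ω) [IsProbabilityMeasure P]
    {A B C : Set Ω} {ε : ℝ} (h : ∀ z ∈ A, z ∉ C → z ∈ B) (hC : P.real C ≤ ε) :
    P.real A ≤ P.real B + ε := by
  have hsub : A ⊆ B ∪ C := fun z hz => by
    by_cases hm : z ∈ C
    · exact Or.inr hm
    · exact Or.inl (h z hz hm)
  have h1 := measureReal_mono (μ := P) hsub
  have h2 := measureReal_union_le (μ := P) B C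
  linarith

lemma uniq {μ η : Measure ℝ} [IsProbabilityMeasure μ] [IsProbabilityMeasure η] {S : ℝ → ℝ} {ρ : ℝ}
    (hρ : 1 < ρ) (hS : Continuous S) (iS : Integrable S μ)
    (h : ∀ ε : ℝ, 0 < ε → ∃ π : Measure (ℝ × ℝ), π.map Prod.fst = μ ∧ π.map Prod.snd = η ∧
      Integrable (fun z : ℝ × ℝ => RR ρ (S z.1) (z.1 - z.2)) π ∧
      ∫ z, RR ρ (S z.1) (z.1 - z.2) ∂π ≤ ε) : η = μ.map (fun x => x - S x) := by
  have hTm : Measurable (fun x => x - S x) := (continuous_id.sub hS).measurable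
  have hP : IsProbabilityMeasure (μ.map (fun x => x - S x)) :=
    Measure.isProbabilityMeasure_map hTm.aemeasurable
  have close : ∀ δ ε : ℝ, 0 < δ → 0 < ε → ∃ π : Measure (ℝ × ℝ), IsProbabilityMeasure π ∧
      π.map Prod.fst = μ ∧ π.map Prod.snd = η ∧
      π.real {z | δ ≤ |z.1 - z.2 - S z.1|} ≤ ε := by
    intro δ ε hδ hε
    set K := ∫ x, |S x| ∂μ
    have hK : 0 ≤ K := integral_nonneg fun x => abs_nonneg _
    set M := 2 * K / ε + 1
    have hM : 0 < M := by positivity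
    have hmk := mul_meas_ge_le_integral_of_nonneg (μ := μ) (f := fun x => |S x|)
      (Filter.Eventually.of_forall fun x => abs_nonneg _) iS.abs M
    have hM1 : μ.real {x | M ≤ |S x|} ≤ ε / 2 := by
      have e1 : K ≤ M * (ε / 2) := by
        have : 2 * K / ε * (ε / 2) = K := by field_simp
        simp only [M, add_mul, this]; linarith
      exact le_of_mul_le_mul_left (hmk.trans e1) hM
    obtain ⟨c, hc, hcl⟩ := RR_lower hρ hδ hM.le
    obtain ⟨π, h1, h2, hi, hle⟩ := h (c * (ε / 2)) (by positivity)
    have hπ : IsProbabilityMeasure π := by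
      constructor
      have : (π.map Prod.fst) univ = 1 := by rw [h1]; simp
      rwa [Measure.map_apply measurable_fst MeasurableSet.univ, preimage_univ] at this
    refine ⟨π, hπ, h1, h2, ?_⟩
    have hmk2 := mul_meas_ge_le_integral_of_nonneg (μ := π)
      (f := fun z : ℝ × ℝ => RR ρ (S z.1) (z.1 - z.2))
      (Filter.Eventually.of_forall fun x => RR_nonneg hρ _ _) hi c
    have hc2 : π.real {z : ℝ × ℝ | c ≤ RR ρ (S z.1) (z.1 - z.2)} ≤ ε / 2 :=
      le_of_mul_le_mul_left (hmk2.trans hle) hc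
    have hBm : MeasurableSet {x | M ≤ |S x|} := (isClosed_le continuous_const hS.abs).measurableSet
    have hc1 : π.real {z : ℝ × ℝ | M ≤ |S z.1|} ≤ ε / 2 := by
      refine le_trans (le_of_eq ?_) hM1
      rw [← h1, map_measureReal_apply measurable_fst hBm]
      rfl
    have hsub : {z : ℝ × ℝ | δ ≤ |z.1 - z.2 - S z.1|} ⊆
        {z | M ≤ |S z.1|} ∪ {z | c ≤ RR ρ (S z.1) (z.1 - z.2)} := by
      intro z hz
      by_cases hm : M ≤ |S z.1|
      · exact Or.inl hm
      · exact Or.inr (hcl _ _ (not_le.1 hm).le hz)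
    calc _ ≤ _ := measureReal_mono hsub
      _ ≤ _ := measureReal_union_le _ _
      _ ≤ ε := by linarith
  refine Measure.ext_of_Iic _ _ fun x => ?_
  rw [← measureReal_eq_measureReal_iff]
  refine le_antisymm (cdf_le_of_close (fun x δ ε hδ hε => ?_) x)
    (cdf_le_of_close (fun x δ ε hδ hε => ?_) x)
  · obtain ⟨π, hπ, h1, h2, hle⟩ := close δ ε hδ hε
    rw [map_measureReal_apply hTm measurableSet_Iic, ← h1, ← h2,
      map_measureReal_apply measurable_snd measurableSet_Iic,
      map_measureReal_apply measurable_fst (hTm measurableSet_Iic)]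
    refine real_union_bound π (fun z hz hm => ?_) hle
    rw [mem_ofPred_eq] at hm
    have := (abs_lt.1 (not_le.1 hm)).2
    simp only [mem_preimage, mem_Iic] at hz ⊢
    linarith
  · obtain ⟨π, hπ, h1, h2, hle⟩ := close δ ε hδ hε
    rw [map_measureReal_apply hTm measurableSet_Iic, ← h1, ← h2,
      map_measureReal_apply measurable_snd measurableSet_Iic,
      map_measureReal_apply measurable_fst (hTm measurableSet_Iic)]
    refine real_union_bound π (fun z hz hm => ?_) hle
    rw [mem_ofPred_eq] at hm
    have := (abs_lt.1 (not_le.1 hm)).1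
    simp only [mem_preimage, mem_Iic] at hz ⊢
    linarith

/-- for `μ, ν ∈ P_1(ℝ)` and `ψ` the convex hull of
`q ↦ ∫_0^q (F_μ^{-1}(p) - F_ν^{-1}(p)) dp` on `[0,1]`, there exists a probability measure
`μ_{P̲(ν)}` with `∫_0^q F_{μ_{P̲(ν)}}^{-1}(p) dp = ∫_0^q F_μ^{-1}(p) dp - ψ(q)` for all
`q ∈ [0,1]`; it satisfies `μ_{P̲(ν)} ≤cx ν` and, for each `ρ > 1` with `μ, ν ∈ P_ρ(ℝ)`,
it is the unique minimizer of `W_ρ(μ,·)` over `{η : η ≤cx ν}`. -/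
theorem stmt6 (μ ν : Measure ℝ)
    [IsProbabilityMeasure μ] [IsProbabilityMeasure ν]
    (hμ1 : Integrable (fun x => |x|) μ) (hν1 : Integrable (fun x => |x|) ν)
    (ψ : ℝ → ℝ)
    (hψconv : ConvexOn ℝ (Icc 0 1) ψ)
    (hψle : ∀ q ∈ Icc (0:ℝ) 1, ψ q ≤ ∫ p in (0:ℝ)..q, (quantileFn μ p - quantileFn ν p))
    (hψmax : ∀ χ : ℝ → ℝ, ConvexOn ℝ (Icc 0 1) χ →
        (∀ q ∈ Icc (0:ℝ) 1, χ q ≤ ∫ p in (0:ℝ)..q, (quantileFn μ p - quantileFn ν p)) →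
        ∀ q ∈ Icc (0:ℝ) 1, χ q ≤ ψ q) :
    ∃ η : Measure ℝ, IsProbabilityMeasure η ∧
      (∀ q ∈ Icc (0:ℝ) 1,
          (∫ p in (0:ℝ)..q, quantileFn η p) = (∫ p in (0:ℝ)..q, quantileFn μ p) - ψ q)
      ∧ ConvexOrder η ν
      ∧ (∀ ρ : ℝ, 1 < ρ → Integrable (fun x => |x| ^ ρ) μ → Integrable (fun x => |x| ^ ρ) ν →
          (Wp ρ μ η = ⨅ (η' : Measure ℝ) (_ : IsProbabilityMeasure η')
              (_ : ConvexOrder η' ν), Wp ρ μ η')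
          ∧ ∀ η' : Measure ℝ, IsProbabilityMeasure η' → ConvexOrder η' ν →
              Wp ρ μ η' = (⨅ (η'' : Measure ℝ) (_ : IsProbabilityMeasure η'')
                (_ : ConvexOrder η'' ν), Wp ρ μ η'') → η' = η) := by
  have iμ := int_of_abs hμ1
  have iν := int_of_abs hν1
  have qm : AEMeasurable (quantileFn μ) lam := aemeas_mono (quantile_mono μ)
  obtain ⟨s, w, S, hs, hw, iw, hform, htail, htot, hS, hae, hct⟩ :=
    struct (quantile_mono μ) (quantile_mono ν) (quantile_integrable μ iμ)
      (quantile_integrable ν iν) hψconv hψle hψmax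
  have hTc : Continuous (fun x => x - S x) := continuous_id.sub hS.continuous
  have hmap : lam.map w = μ.map (fun x => x - S x) := by
    conv_rhs => rw [← quantile_map μ]
    rw [AEMeasurable.map_map_of_aemeasurable hTc.measurable.aemeasurable qm]
    apply Measure.map_congr
    filter_upwards [hae] with p hp
    simp [hp.1, hp.2]
  have hη : IsProbabilityMeasure (lam.map w) := Measure.isProbabilityMeasure_map (aemeas_mono hw)
  have hcx : ConvexOrder (lam.map w) ν := by
    have := cx_of_monotone hw (quantile_mono ν) iw (quantile_integrable ν iν) htail
      (by rw [lam_int, lam_int, htot])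
    rwa [quantile_map ν] at this
  refine ⟨lam.map w, hη, fun q hq => ?_, hcx, fun ρ hρ hμρ hνρ => ?_⟩
  · rw [ae_lam_eq_ivl (quantile_of_map hw) ⟨le_rfl, zero_le_one⟩ hq, hform q hq]
  have hpc : Continuous (fun x => |S x| ^ ρ) :=
    (hS.continuous.abs).rpow_const fun x => Or.inr (by linarith)
  have mμ : MemLp (fun x => x) (ENNReal.ofReal ρ) μ :=
    (memLp_abs_iff hρ continuous_id.aestronglyMeasurable).1 hμρ
  have mS := memLp_lip hS mμ
  have iSρ : Integrable (fun x => |S x| ^ ρ) μ := (memLp_abs_iff hρ mS.1).2 mS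
  have iS : Integrable S μ := mS.integrable (by simpa using hρ.le)
  have low : ∀ η' : Measure ℝ, IsProbabilityMeasure η' → ConvexOrder η' ν →
      ENNReal.ofReal (∫ x, |S x| ^ ρ ∂μ) ≤ Wp ρ μ η' := by
    intro η' hη' hcx'
    refine le_iInf fun π => le_iInf fun h1 => le_iInf fun h2 => ?_
    obtain ⟨ia, ib, hle⟩ := lower hν1 hμ1 hcx' hρ hμρ hνρ hs hS hae htot hct π h1 h2
    have h0 : 0 ≤ ∫ z, RR ρ (S z.1) (z.1 - z.2) ∂π := integral_nonneg fun z => RR_nonneg hρ _ _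
    simp only [Real.norm_eq_abs]
    rw [← ofReal_integral_eq_lintegral_ofReal ia
      (Filter.Eventually.of_forall fun z => by positivity)]
    exact ENNReal.ofReal_le_ofReal (by linarith)
  have up : Wp ρ μ (lam.map w) ≤ ENNReal.ofReal (∫ x, |S x| ^ ρ ∂μ) := by
    have hpm : Measurable (fun x : ℝ => (x, x - S x)) := measurable_id.prodMk hTc.measurable
    refine iInf_le_of_le (μ.map (fun x => (x, x - S x))) (iInf_le_of_le ?_ (iInf_le_of_le ?_ ?_))
    · rw [Measure.map_map measurable_fst hpm]
      exact Measure.map_id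
    · rw [Measure.map_map measurable_snd hpm, hmap]
      rfl
    · rw [lintegral_map (by fun_prop) hpm, ofReal_integral_eq_lintegral_ofReal iSρ
        (Filter.Eventually.of_forall fun z => by positivity)]
      simp
  have hinf : (⨅ (η' : Measure ℝ) (_ : IsProbabilityMeasure η') (_ : ConvexOrder η' ν), Wp ρ μ η')
      = ENNReal.ofReal (∫ x, |S x| ^ ρ ∂μ) :=
    le_antisymm (iInf_le_of_le (lam.map w) (iInf_le_of_le hη (iInf_le_of_le hcx up)))
      (le_iInf fun η' => le_iInf fun h1 => le_iInf fun h2 => low η' h1 h2)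
  refine ⟨by rw [hinf]; exact le_antisymm up (low _ hη hcx), fun η' hη' hcx' heq => ?_⟩
  rw [hinf] at heq
  rw [hmap]
  refine uniq hρ hS.continuous iS fun ε hε => ?_
  have h0 : 0 ≤ ∫ x, |S x| ^ ρ ∂μ := integral_nonneg fun z => by positivity
  have hlt : Wp ρ μ η' < ENNReal.ofReal (∫ x, |S x| ^ ρ ∂μ + ε) := by
    rw [heq]; exact (ENNReal.ofReal_lt_ofReal_iff (by linarith)).2 (by linarith)
  unfold Wp at hlt
  simp only [iInf_lt_iff] at hlt
  obtain ⟨π, h1, h2, hlt⟩ := hlt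
  obtain ⟨ia, ib, hle⟩ := lower hν1 hμ1 hcx' hρ hμρ hνρ hs hS hae htot hct π h1 h2
  refine ⟨π, h1, h2, ib, ?_⟩
  simp only [Real.norm_eq_abs] at hlt
  rw [← ofReal_integral_eq_lintegral_ofReal ia
      (Filter.Eventually.of_forall fun z => by positivity),
    ENNReal.ofReal_lt_ofReal_iff (by linarith)] at hlt
  linarith
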